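/- arXiv:math/0305161 — 3 statements merged into one kernel-verified Lean document; each statement's English description precedes it below -/
import Mathlib

section
/- Let t = 1260r + 169 for some integer r ≥ 1, and let n be an integer with n ≥ 540t² + (175811/2)t + 7989/2. Then f(n) ≥ n + 36t, where f(n) denotes the maximum number of edges in a simple graph on n vertices in which no two distinct cycles have the same length. -/
/-- A simple graph has the property that any two distinct cycles (as subgraphs,
identified with their edge sets) have different lengths. -/
def DistinctCycleLengths {V : Type*} (G : SimpleGraph V) : Prop :=
  ∀ ⦃u v : V⦄ (c₁ : G.Walk u u) (c₂ : G.Walk v v),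
    c₁.IsCycle → c₂.IsCycle → c₁.length = c₂.length →
    {e | e ∈ c₁.edges} = {e | e ∈ c₂.edges}

/-- `maxEdges n` is the maximum number of edges in a simple graph on `n` vertices
in which no two distinct cycles have the same length. -/
noncomputable def maxEdges (n : ℕ) : ℕ :=
  sSup {m : ℕ | ∃ G : SimpleGraph (Fin n), DistinctCycleLengths G ∧ G.edgeSet.ncard = m}

theorem isAcyclic_of_rank {V : Type*} {F : SimpleGraph V} (rank : V → ℕ)
    (h : ∀ v a b, F.Adj v a → F.Adj v b → rank a ≤ rank v → rank b ≤ rank v → a = b) :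
    F.IsAcyclic := by
  classical
  intro u c hc
  obtain ⟨v, hv, hmax⟩ := c.support.toFinset.exists_max_image rank ⟨u, by simp⟩
  rw [List.mem_toFinset] at hv
  have hc' := hc.rotate hv
  have hle : ∀ w ∈ (c.rotate v hv).support, rank w ≤ rank v := fun w hw =>
    hmax w (List.mem_toFinset.2 ((c.mem_support_rotate_iff v hv).1 hw))
  exact hc'.snd_ne_penultimate <| h v _ _ ((c.rotate v hv).adj_snd hc'.not_nil)
    ((c.rotate v hv).adj_penultimate hc'.not_nil).symm
    (hle _ (SimpleGraph.Walk.getVert_mem_support _ _))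
    (hle _ (SimpleGraph.Walk.getVert_mem_support _ _))

/-- The graph obtained from `F` by joining the vertex `x` to every vertex of `S`. -/
def apexGraph {V : Type*} (F : SimpleGraph V) (x : V) (S : Set V) : SimpleGraph V :=
  F ⊔ SimpleGraph.fromRel fun a b => a = x ∧ b ∈ S

section apexGraph

variable {V : Type*} {F : SimpleGraph V} {x : V} {S : Set V}

theorem apexGraph_adj_apex (hx : ∀ v, ¬ F.Adj x v) {v : V} (h : (apexGraph F x S).Adj x v) :
    v ∈ S := by
  simp only [apexGraph, SimpleGraph.sup_adj, SimpleGraph.fromRel_adj, hx, false_or] at h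
  grind

theorem apexGraph_mem_edgeSet {e : Sym2 V} (he : e ∈ (apexGraph F x S).edgeSet) (hxe : x ∉ e) :
    e ∈ F.edgeSet := by
  induction e with | _ a b =>
  simp only [apexGraph, SimpleGraph.mem_edgeSet, SimpleGraph.sup_adj, SimpleGraph.fromRel_adj,
    Sym2.mem_iff] at he hxe ⊢
  grind

theorem exists_isPath_of_isCycle (hF : F.IsAcyclic) (hx : ∀ v, ¬ F.Adj x v) {u : V}
    (c : (apexGraph F x S).Walk u u) (hc : c.IsCycle) :
    ∃ (p q : V) (w : F.Walk p q), w.IsPath ∧ p ∈ S ∧ q ∈ S ∧ p ≠ q ∧ c.length = w.length + 2 ∧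
      ∀ e, e ∈ c.edges ↔ e = s(x, p) ∨ e = s(x, q) ∨ e ∈ w.edges := by
  classical
  have transfer_mem : ∀ {a b : V} (w : (apexGraph F x S).Walk a b), x ∉ w.support →
      ∀ e ∈ w.edges, e ∈ F.edgeSet := fun w hw e he =>
    apexGraph_mem_edgeSet (w.edges_subset_edgeSet he)
      fun hxe => hw (w.mem_support_of_mem_edges he hxe)
  have hxc : x ∈ c.support := by
    by_contra hxc
    exact hF _ (hc.transfer (transfer_mem c hxc))
  have hc' := hc.rotate hxc
  have hlen := c.length_rotate x hxc
  have hedges := fun e => (c.rotate_edges x hxc).mem_iff (a := e)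
  generalize c.rotate x hxc = d at hc' hlen hedges
  cases d with
  | nil => exact absurd rfl hc'.ne_nil
  | @cons _ p _ hp w₀ =>
    rw [SimpleGraph.Walk.cons_isCycle_iff] at hc'
    obtain ⟨hw₀, hpe⟩ := hc'
    have hw₁ := hw₀.reverse
    have hlen₁ := w₀.length_reverse
    have hedges₁ : ∀ e, e ∈ w₀.reverse.edges ↔ e ∈ w₀.edges := by simp
    generalize w₀.reverse = w₁ at hw₁ hlen₁ hedges₁
    cases w₁ with
    | nil => exact absurd hp (SimpleGraph.irrefl _)
    | @cons _ q _ hq w =>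
      rw [SimpleGraph.Walk.cons_isPath_iff] at hw₁
      refine ⟨q, p, w.transfer F (transfer_mem w hw₁.2), hw₁.1.transfer _,
        apexGraph_adj_apex hx hq, apexGraph_adj_apex hx hp, ?_, ?_, ?_⟩
      · rintro rfl
        exact hpe ((hedges₁ _).1 (by simp))
      · simp only [SimpleGraph.Walk.length_cons, SimpleGraph.Walk.length_transfer] at *
        omega
      · intro e
        rw [← hedges, SimpleGraph.Walk.edges_transfer]
        simp only [SimpleGraph.Walk.edges_cons, List.mem_cons, ← hedges₁]
        tauto

theorem distinctCycleLengths_apexGraph (hF : F.IsAcyclic) (hx : ∀ v, ¬ F.Adj x v)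
    (hS : ∀ (p q p' q' : V) (w : F.Walk p q) (w' : F.Walk p' q'), p ∈ S → q ∈ S → p' ∈ S →
      q' ∈ S → p ≠ q → p' ≠ q' → w.IsPath → w'.IsPath → w.length = w'.length →
      p = p' ∧ q = q' ∨ p = q' ∧ q = p') :
    DistinctCycleLengths (apexGraph F x S) := by
  intro u v c₁ c₂ hc₁ hc₂ hlen
  obtain ⟨p, q, w, hw, hp, hq, hpq, hl, he⟩ := exists_isPath_of_isCycle hF hx c₁ hc₁
  obtain ⟨p', q', w', hw', hp', hq', hpq', hl', he'⟩ := exists_isPath_of_isCycle hF hx c₂ hc₂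
  ext e
  rw [Set.mem_ofPred_eq, Set.mem_ofPred_eq, he, he']
  obtain ⟨rfl, rfl⟩ | ⟨rfl, rfl⟩ :=
    hS p q p' q' w w' hp hq hp' hq' hpq hpq' hw hw' (by omega)
  · have := congrArg Subtype.val ((hF.subsingleton_path _ _).elim ⟨w, hw⟩ ⟨w', hw'⟩)
    simp only at this
    rw [this]
  · have := congrArg Subtype.val ((hF.subsingleton_path _ _).elim ⟨w, hw⟩ ⟨w'.reverse, hw'.reverse⟩)
    simp only at this
    rw [this, SimpleGraph.Walk.edges_reverse, List.mem_reverse]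
    tauto

end apexGraph

theorem DistinctCycleLengths.comap {V W : Type*} {G : SimpleGraph W}
    (hG : DistinctCycleLengths G) (f : V ↪ W) : DistinctCycleLengths (G.comap f) := by
  intro u v c₁ c₂ hc₁ hc₂ hlen
  let φ : G.comap f →g G := ⟨f, fun h => h⟩
  have hφ : Function.Injective φ := f.injective
  have key := hG (c₁.map φ) (c₂.map φ) (hc₁.map hφ) (hc₂.map hφ) (by simpa using hlen)
  ext e
  have := congrArg (Sym2.map φ e ∈ ·) key
  simpa [SimpleGraph.Walk.edges_map, (Sym2.map.injective hφ).eq_iff] using this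

theorem le_maxEdges {W : Type*} {G : SimpleGraph W} (hG : DistinctCycleLengths G) {n : ℕ}
    (f : Fin n ↪ W) (E : Finset (Sym2 W)) (hE : ∀ e ∈ E, e ∈ G.edgeSet ∧ ∀ v ∈ e, v ∈ Set.range f) :
    E.card ≤ maxEdges n := by
  have hsub : (E : Set (Sym2 W)) ⊆ Sym2.map f '' (G.comap f).edgeSet := by
    intro e he
    obtain ⟨h₁, h₂⟩ := hE e he
    induction e with | _ a b =>
    obtain ⟨i, rfl⟩ := h₂ a (by simp)
    obtain ⟨j, rfl⟩ := h₂ b (by simp)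
    exact ⟨s(i, j), h₁, rfl⟩
  calc E.card = (E : Set (Sym2 W)).ncard := (Set.ncard_coe_finset E).symm
    _ ≤ (Sym2.map f '' (G.comap f).edgeSet).ncard := Set.ncard_le_ncard hsub (Set.toFinite _)
    _ ≤ (G.comap f).edgeSet.ncard := Set.ncard_image_le (Set.toFinite _)
    _ ≤ maxEdges n := by
      refine le_csSup ⟨(Set.univ : Set (Sym2 (Fin n))).ncard, ?_⟩ ⟨_, hG.comap f, rfl⟩
      rintro m ⟨H, -, rfl⟩
      exact Set.ncard_le_ncard (Set.subset_univ _) (Set.toFinite _)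

/-- The parent of a vertex of the comb `ℕ × ℕ`, whose spine is `{(s, 0)}` and whose teeth are
`{(s, h)}` for fixed `s`; the root `(0, 0)` is its own parent. -/
def combParent : ℕ × ℕ → ℕ × ℕ
  | (s, 0) => (s - 1, 0)
  | (s, h + 1) => (s, h)

/-- The distance in the comb from `p` to `q`. -/
def combDist (p q : ℕ × ℕ) : ℕ :=
  if p.1 = q.1 then (p.2 - q.2) + (q.2 - p.2) else (p.1 - q.1) + (q.1 - p.1) + p.2 + q.2

/-- A family of disjoint combs indexed by `ι`, together with an isolated vertex `none`. -/
def combForest (ι : Type*) : SimpleGraph (Option ((_ : ι) × ℕ × ℕ)) :=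
  SimpleGraph.fromRel fun a b => ∃ i p, a = some ⟨i, p⟩ ∧ b = some ⟨i, combParent p⟩

section combForest

variable {ι : Type*}

theorem combParent_of_ne {p : ℕ × ℕ} (hp : p ≠ (0, 0)) :
    (combParent p).1 + (combParent p).2 + 1 = p.1 + p.2 := by
  obtain ⟨s, _ | h⟩ := p
  · have : s ≠ 0 := by rintro rfl; exact hp rfl
    simp only [combParent]
    omega
  · simp only [combParent]
    omega

theorem combParent_ne {p : ℕ × ℕ} (hp : p ≠ (0, 0)) : combParent p ≠ p := by
  intro h
  have := combParent_of_ne hp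
  rw [h] at this
  omega

theorem combForest_adj_some {i j : ι} {p q : ℕ × ℕ} :
    (combForest ι).Adj (some ⟨i, p⟩) (some ⟨j, q⟩) ↔
      i = j ∧ (p ≠ (0, 0) ∧ q = combParent p ∨ q ≠ (0, 0) ∧ p = combParent q) := by
  simp only [combForest, SimpleGraph.fromRel_adj, Option.some.injEq, Sigma.mk.injEq, heq_eq_eq]
  constructor
  · rintro ⟨hne, ⟨i', p', ⟨rfl, rfl⟩, rfl, rfl⟩ | ⟨i', p', ⟨rfl, rfl⟩, rfl, rfl⟩⟩
    · refine ⟨rfl, Or.inl ⟨?_, rfl⟩⟩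
      rintro rfl
      exact hne rfl
    · refine ⟨rfl, Or.inr ⟨?_, rfl⟩⟩
      rintro rfl
      exact hne rfl
  · rintro ⟨rfl, ⟨hp, rfl⟩ | ⟨hq, rfl⟩⟩
    · exact ⟨fun h => combParent_ne hp (by simpa using h.symm), Or.inl ⟨i, p, ⟨rfl, rfl⟩, rfl, rfl⟩⟩
    · exact ⟨fun h => combParent_ne hq (by simpa using h), Or.inr ⟨i, q, ⟨rfl, rfl⟩, rfl, rfl⟩⟩

theorem not_combForest_adj_none (v : Option ((_ : ι) × ℕ × ℕ)) :
    ¬ (combForest ι).Adj none v := by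
  simp [combForest]

theorem combForest_isAcyclic : (combForest ι).IsAcyclic := by
  refine isAcyclic_of_rank (fun v => v.elim 0 fun z => z.2.1 + z.2.2) fun v a b ha hb hra hrb => ?_
  rcases v with _ | ⟨i, p⟩
  · exact absurd ha (not_combForest_adj_none _)
  rcases a with _ | ⟨j, a⟩
  · exact absurd ha.symm (not_combForest_adj_none _)
  rcases b with _ | ⟨k, b⟩
  · exact absurd hb.symm (not_combForest_adj_none _)
  rw [combForest_adj_some] at ha hb
  have parent_of_le : ∀ {q : ℕ × ℕ}, q.1 + q.2 ≤ p.1 + p.2 →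
      (p ≠ (0, 0) ∧ q = combParent p ∨ q ≠ (0, 0) ∧ p = combParent q) → q = combParent p := by
    rintro q hle (⟨-, h⟩ | ⟨hq, rfl⟩)
    · exact h
    · have := combParent_of_ne hq
      omega
  obtain ⟨rfl, ha⟩ := ha
  obtain ⟨rfl, hb⟩ := hb
  rw [parent_of_le (q := a) hra ha, parent_of_le (q := b) hrb hb]

theorem combDist_le_combParent_add_one {p : ℕ × ℕ} (q : ℕ × ℕ) :
    combDist p q ≤ combDist (combParent p) q + 1 ∧
      combDist (combParent p) q ≤ combDist p q + 1 := by
  obtain ⟨s, _ | h⟩ := p <;> obtain ⟨s', h'⟩ := q <;> simp only [combDist, combParent] <;>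
    constructor <;> grind

theorem combForest_walk {a b : Option ((_ : ι) × ℕ × ℕ)} (w : (combForest ι).Walk a b)
    {j : ι} {q : ℕ × ℕ} (hb : b = some ⟨j, q⟩) :
    ∃ p, a = some ⟨j, p⟩ ∧ combDist p q ≤ w.length := by
  induction w with
  | nil => exact ⟨q, hb, by simp [combDist]⟩
  | @cons a c _ h w ih =>
    obtain ⟨p, rfl, hp⟩ := ih hb
    rcases a with _ | ⟨i, a⟩
    · exact absurd h (not_combForest_adj_none _)
    rw [combForest_adj_some] at h
    obtain ⟨rfl, ⟨-, rfl⟩ | ⟨-, rfl⟩⟩ := h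
    · refine ⟨a, rfl, ?_⟩
      have := (combDist_le_combParent_add_one (p := a) q).1
      rw [SimpleGraph.Walk.length_cons]
      omega
    · refine ⟨_, rfl, ?_⟩
      have := (combDist_le_combParent_add_one (p := p) q).2
      rw [SimpleGraph.Walk.length_cons]
      omega

theorem exists_combForest_walk_tooth (i : ι) (s h : ℕ) :
    ∃ w : (combForest ι).Walk (some ⟨i, (s, h)⟩) (some ⟨i, (s, 0)⟩), w.length = h := by
  induction h with
  | zero => exact ⟨.nil, rfl⟩
  | succ h ih =>
    obtain ⟨w, hw⟩ := ih
    have hadj : (combForest ι).Adj (some ⟨i, (s, h + 1)⟩) (some ⟨i, (s, h)⟩) :=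
      combForest_adj_some.2 ⟨rfl, Or.inl ⟨by simp, rfl⟩⟩
    exact ⟨.cons hadj w, by simp [hw]⟩

theorem exists_combForest_walk_spine (i : ι) (s k : ℕ) :
    ∃ w : (combForest ι).Walk (some ⟨i, (s + k, 0)⟩) (some ⟨i, (s, 0)⟩), w.length = k := by
  induction k with
  | zero => exact ⟨.nil, rfl⟩
  | succ k ih =>
    obtain ⟨w, hw⟩ := ih
    have hadj : (combForest ι).Adj (some ⟨i, (s + (k + 1), 0)⟩) (some ⟨i, (s + k, 0)⟩) :=
      combForest_adj_some.2 ⟨rfl, Or.inl ⟨by simp, rfl⟩⟩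
    exact ⟨.cons hadj w, by simp [hw]⟩

theorem exists_combForest_walk (i : ι) {p q : ℕ × ℕ} (hpq : p.1 < q.1) :
    ∃ w : (combForest ι).Walk (some ⟨i, p⟩) (some ⟨i, q⟩), w.length = combDist p q := by
  obtain ⟨s, h⟩ := p
  obtain ⟨s', h'⟩ := q
  obtain ⟨k, rfl⟩ := Nat.exists_eq_add_of_le hpq.le
  obtain ⟨w₁, hw₁⟩ := exists_combForest_walk_tooth i s h
  obtain ⟨w₂, hw₂⟩ := exists_combForest_walk_spine i s k
  obtain ⟨w₃, hw₃⟩ := exists_combForest_walk_tooth i (s + k) h'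
  refine ⟨(w₁.append w₂.reverse).append w₃.reverse, ?_⟩
  simp only [SimpleGraph.Walk.length_append, SimpleGraph.Walk.length_reverse, hw₁, hw₂, hw₃,
    combDist]
  simp only at hpq
  split_ifs <;> omega

theorem length_eq_combDist {i : ι} {p q : ℕ × ℕ} (hpq : p.1 < q.1)
    (w : (combForest ι).Walk (some ⟨i, p⟩) (some ⟨i, q⟩)) (hw : w.IsPath) :
    w.length = combDist p q := by
  classical
  obtain ⟨w', hw'⟩ := exists_combForest_walk i hpq
  have h₁ := congrArg Subtype.val
    ((combForest_isAcyclic.subsingleton_path _ _).elim ⟨w, hw⟩ ⟨_, w'.bypass_isPath⟩)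
  simp only at h₁
  have h₂ := w'.length_bypass_le_length
  obtain ⟨p', hp', h₃⟩ := combForest_walk w rfl
  simp only [Option.some.injEq, Sigma.mk.injEq, heq_eq_eq, true_and] at hp'
  subst hp'
  rw [h₁] at h₃ ⊢
  omega

end combForest

section combGraph

variable {ι : Type*} {B : Finset ι} {W M : ι → Finset (ℕ × ℕ)}

theorem distinctCycleLengths_combs
    (hM : ∀ i ∈ B, ∀ p ∈ M i, ∀ q ∈ M i, p.1 = q.1 → p = q)
    (hdist : ∀ i ∈ B, ∀ j ∈ B, ∀ p ∈ M i, ∀ q ∈ M i, ∀ p' ∈ M j, ∀ q' ∈ M j,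
      p.1 < q.1 → p'.1 < q'.1 → combDist p q = combDist p' q' → i = j ∧ p = p' ∧ q = q') :
    DistinctCycleLengths (apexGraph (combForest ι) none {v | ∃ z ∈ B.sigma M, v = some z}) := by
  have oriented : ∀ (a b : Option ((_ : ι) × ℕ × ℕ)) (w : (combForest ι).Walk a b),
      (∃ z ∈ B.sigma M, a = some z) → (∃ z ∈ B.sigma M, b = some z) → a ≠ b → w.IsPath →
      ∃ i ∈ B, ∃ p ∈ M i, ∃ q ∈ M i, p.1 < q.1 ∧ w.length = combDist p q ∧
        (a = some ⟨i, p⟩ ∧ b = some ⟨i, q⟩ ∨ a = some ⟨i, q⟩ ∧ b = some ⟨i, p⟩) := by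
    rintro _ _ w ⟨⟨i, p⟩, hp, rfl⟩ ⟨⟨j, q⟩, hq, rfl⟩ hne hw
    obtain ⟨p', hp', -⟩ := combForest_walk w rfl
    simp only [Option.some.injEq, Sigma.mk.injEq, heq_eq_eq] at hp'
    obtain ⟨rfl, -⟩ := hp'
    rw [Finset.mem_sigma] at hp hq
    rcases lt_trichotomy p.1 q.1 with h | h | h
    · exact ⟨i, hp.1, p, hp.2, q, hq.2, h, length_eq_combDist h w hw, Or.inl ⟨rfl, rfl⟩⟩
    · exact absurd (by rw [hM i hp.1 p hp.2 q hq.2 h]) hne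
    · refine ⟨i, hp.1, q, hq.2, p, hp.2, h, ?_, Or.inr ⟨rfl, rfl⟩⟩
      rw [← length_eq_combDist h w.reverse hw.reverse, SimpleGraph.Walk.length_reverse]
  refine distinctCycleLengths_apexGraph combForest_isAcyclic not_combForest_adj_none ?_
  intro a b a' b' w w' ha hb ha' hb' hab hab' hw hw' hlen
  obtain ⟨i, hi, p, hp, q, hq, hpq, hl, h⟩ := oriented a b w ha hb hab hw
  obtain ⟨j, hj, p', hp', q', hq', hpq', hl', h'⟩ := oriented a' b' w' ha' hb' hab' hw'
  obtain ⟨rfl, rfl, rfl⟩ := hdist i hi j hj p hp q hq p' hp' q' hq' hpq hpq' (by omega)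
  rcases h with ⟨rfl, rfl⟩ | ⟨rfl, rfl⟩ <;> rcases h' with ⟨rfl, rfl⟩ | ⟨rfl, rfl⟩ <;> simp

theorem le_maxEdges_combs
    (hMW : ∀ i ∈ B, M i ⊆ W i) (hW : ∀ i ∈ B, ∀ p ∈ W i, combParent p ∈ W i)
    (hM : ∀ i ∈ B, ∀ p ∈ M i, ∀ q ∈ M i, p.1 = q.1 → p = q)
    (hdist : ∀ i ∈ B, ∀ j ∈ B, ∀ p ∈ M i, ∀ q ∈ M i, ∀ p' ∈ M j, ∀ q' ∈ M j,
      p.1 < q.1 → p'.1 < q'.1 → combDist p q = combDist p' q' → i = j ∧ p = p' ∧ q = q')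
    {n : ℕ} (hn : ∑ i ∈ B, (W i).card + 1 = n) :
    n + ∑ i ∈ B, (M i).card ≤ maxEdges n + 1 + B.card := by
  classical
  set T := Finset.insertNone (B.sigma W) with hT
  have hTn : T.card = n := by rw [hT, Finset.card_insertNone, Finset.card_sigma, hn]
  let f : Fin n ↪ Option ((_ : ι) × ℕ × ℕ) :=
    (T.equivFinOfCardEq hTn).symm.toEmbedding.trans (Function.Embedding.subtype _)
  have hf : ∀ v ∈ T, v ∈ Set.range f := fun v hv => ⟨T.equivFinOfCardEq hTn ⟨v, hv⟩, by simp [f]⟩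
  let up : (_ : ι) × ℕ × ℕ → Sym2 (Option ((_ : ι) × ℕ × ℕ)) :=
    fun z => s(some z, some ⟨z.1, combParent z.2⟩)
  let spoke : (_ : ι) × ℕ × ℕ → Sym2 (Option ((_ : ι) × ℕ × ℕ)) := fun z => s(none, some z)
  let R := B.sigma fun i => (W i).erase (0, 0)
  have hE := le_maxEdges (distinctCycleLengths_combs hM hdist) f
    (R.image up ∪ (B.sigma M).image spoke) ?_
  · rw [Finset.card_union_of_disjoint, Finset.card_image_of_injOn, Finset.card_image_of_injOn,
      Finset.card_sigma, Finset.card_sigma] at hE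
    · have : ∑ i ∈ B, (W i).card ≤ ∑ i ∈ B, ((W i).erase (0, 0)).card + B.card := by
        rw [Finset.card_eq_sum_ones, ← Finset.sum_add_distrib]
        refine Finset.sum_le_sum fun i _ => ?_
        have := Finset.pred_card_le_card_erase (s := W i) (a := (0, 0))
        omega
      omega
    · intro a _ b _ hab
      simpa [spoke] using hab
    · rintro ⟨i, p⟩ hp ⟨j, q⟩ hq hpq
      simp only [R, Finset.coe_sigma, Set.mem_sigma_iff, Finset.mem_coe, Finset.mem_erase] at hp hq
      simp only [up, Sym2.eq_iff, Option.some.injEq, Sigma.mk.injEq, heq_eq_eq] at hpq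
      rcases hpq with ⟨⟨rfl, rfl⟩, -⟩ | ⟨⟨rfl, h₁⟩, -, h₂⟩
      · rfl
      · have h₃ := combParent_of_ne hp.2.1
        have h₄ := combParent_of_ne hq.2.1
        rw [h₂] at h₃
        rw [← h₁] at h₄
        omega
    · rw [Finset.disjoint_left]
      simp only [Finset.mem_image, not_exists, not_and]
      rintro _ ⟨a, -, rfl⟩ b - h
      simp [up, spoke] at h
  · intro e he
    simp only [Finset.mem_union, Finset.mem_image] at he
    rcases he with ⟨⟨i, p⟩, hz, rfl⟩ | ⟨z, hz, rfl⟩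
    · simp only [R, Finset.mem_sigma, Finset.mem_erase] at hz
      refine ⟨Or.inl (combForest_adj_some.2 ⟨rfl, Or.inl ⟨hz.2.1, rfl⟩⟩), fun v hv => hf v ?_⟩
      simp only [up, Sym2.mem_iff] at hv
      rcases hv with rfl | rfl
      · simp [hT, hz]
      · simp [hT, hz, hW i hz.1 p hz.2.2]
    · refine ⟨Or.inr ?_, fun v hv => hf v ?_⟩
      · exact (SimpleGraph.fromRel_adj _ _ _).2 ⟨by simp, Or.inl ⟨rfl, z, hz, rfl⟩⟩
      · simp only [spoke, Sym2.mem_iff] at hv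
        rw [Finset.mem_sigma] at hz
        rcases hv with rfl | rfl
        · simp [hT]
        · simp [hT, hz.1, hMW _ hz.1 hz.2]

end combGraph

theorem combDist_of_lt {p q : ℕ × ℕ} (h : p.1 < q.1) :
    combDist p q = q.1 - p.1 + p.2 + q.2 := by
  rw [combDist, if_neg h.ne]
  omega

/-- The part of the comb consisting of the first `N` vertices of the spine and, for every
`m ∈ M`, the vertices of the tooth at `m.1` up to height `m.2`. -/
def combPart (N : ℕ) (M : Finset (ℕ × ℕ)) : Finset (ℕ × ℕ) :=
  Finset.range N ×ˢ {0} ∪ M.biUnion fun m => {m.1} ×ˢ Finset.range (m.2 + 1)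

theorem mem_combPart {N : ℕ} {M : Finset (ℕ × ℕ)} {p : ℕ × ℕ} :
    p ∈ combPart N M ↔ p.1 < N ∧ p.2 = 0 ∨ ∃ m ∈ M, p.1 = m.1 ∧ p.2 ≤ m.2 := by
  obtain ⟨s, h⟩ := p
  simp only [combPart, Finset.mem_union, Finset.mem_product, Finset.mem_range,
    Finset.mem_singleton, Finset.mem_biUnion, Nat.lt_succ_iff]

theorem subset_combPart (N : ℕ) (M : Finset (ℕ × ℕ)) : M ⊆ combPart N M :=
  fun m hm => mem_combPart.2 (Or.inr ⟨m, hm, rfl, le_rfl⟩)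

theorem combParent_mem_combPart {N : ℕ} {M : Finset (ℕ × ℕ)} (hM : ∀ m ∈ M, m.1 < N)
    {p : ℕ × ℕ} (hp : p ∈ combPart N M) : combParent p ∈ combPart N M := by
  rw [mem_combPart] at hp ⊢
  obtain ⟨s, _ | h⟩ := p
  · refine Or.inl ⟨?_, rfl⟩
    simp only [combParent] at hp ⊢
    rcases hp with ⟨hs, -⟩ | ⟨m, hm, rfl, -⟩
    · omega
    · have := hM m hm
      omega
  · rcases hp with ⟨-, h₀⟩ | ⟨m, hm, rfl, hh⟩
    · exact absurd h₀ (Nat.succ_ne_zero h)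
    · exact Or.inr ⟨m, hm, rfl, (Nat.le_succ h).trans hh⟩

theorem card_combPart_le (N : ℕ) (M : Finset (ℕ × ℕ)) :
    (combPart N M).card ≤ N + ∑ m ∈ M, (m.2 + 1) := by
  refine (Finset.card_union_le _ _).trans (Nat.add_le_add (by simp) ?_)
  exact Finset.card_biUnion_le.trans (by simp)

section blocks

/-- The number of blocks of each kind: cycles of every length in `[3, 10 * h)`, cycles of every
even length in `[10 * h, 12 * h)`, fans with seven spokes, theta graphs, and one comb that is not
joined to the apex. -/
def blockCount (h : ℕ) : Fin 5 → ℕ := ![10 * h - 3, h, h - 1, h - 1, 1]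

/-- The number of vertices of the spine of each block. -/
def blockSpine (h f : ℕ) : (_ : Fin 5) × ℕ → ℕ := fun b =>
  ![b.2 + 2, 10 * h + 2 * b.2 - 1, 30 * h + 2 * b.2, 14 * h + 2 * b.2, f] b.1

/-- The vertices of each block that are joined to the apex. -/
def blockMarks (h : ℕ) : (_ : Fin 5) × ℕ → List (ℕ × ℕ) := fun b =>
  ![[(0, 0), (b.2 + 1, 0)],
    [(0, 0), (10 * h + 2 * b.2 - 2, 0)],
    [(0, 0), (4 * h + b.2 - 1, 8 * h + b.2), (10 * h + b.2 - 1, 6 * h + b.2),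
      (15 * h + b.2 - 1, 7 * h + b.2 - 1), (21 * h + b.2 - 1, 7 * h + b.2),
      (25 * h + b.2 - 1, 7 * h + b.2), (30 * h + 2 * b.2 - 1, 0)],
    [(0, 0), (9 * h + b.2 - 1, 5 * h + b.2 - 1), (14 * h + 2 * b.2 - 1, 0)],
    []] b.1

/-- The block and the positions of the two spokes of the cycle of length `2 * h * k + r`,
where `r < 2 * h`. -/
def blockDecode (h k r : ℕ) : ((_ : Fin 5) × ℕ) × ℕ × ℕ :=
  if k < 5 then (⟨0, 2 * h * k + r - 3⟩, 0, 1) else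
    match k, r % 2 with
    | 5, 0 => (⟨1, r / 2⟩, 0, 1)
    | 5, 1 => (⟨3, r / 2⟩, 1, 2)
    | 6, 0 => (⟨2, r / 2 - 1⟩, 5, 6)
    | 6, 1 => (⟨2, r / 2⟩, 0, 1)
    | 7, 0 => (⟨3, r / 2⟩, 0, 1)
    | 7, 1 => (⟨3, r / 2⟩, 0, 2)
    | 8, 0 => (⟨2, r / 2 - 1⟩, 4, 6)
    | 8, 1 => (⟨2, r / 2⟩, 0, 2)
    | 9, 0 => (⟨2, r / 2 - 1⟩, 4, 5)
    | 9, 1 => (⟨2, r / 2⟩, 2, 3)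
    | 10, 0 => (⟨2, r / 2 - 1⟩, 1, 2)
    | 10, 1 => (⟨2, r / 2⟩, 3, 4)
    | 11, 0 => (⟨2, r / 2⟩, 0, 3)
    | 11, 1 => (⟨2, r / 2⟩, 3, 6)
    | 12, 0 => (⟨2, r / 2 - 1⟩, 2, 4)
    | 12, 1 => (⟨2, r / 2⟩, 3, 5)
    | 13, 0 => (⟨2, r / 2 - 1⟩, 2, 6)
    | 13, 1 => (⟨2, r / 2⟩, 1, 3)
    | 14, 0 => (⟨2, r / 2 - 1⟩, 2, 5)
    | 14, 1 => (⟨2, r / 2⟩, 0, 4)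
    | 15, 1 => (⟨2, r / 2⟩, 0, 6)
    | 16, 0 => (⟨2, r / 2 - 1⟩, 1, 4)
    | 16, 1 => (⟨2, r / 2⟩, 0, 5)
    | 17, 0 => (⟨2, r / 2 - 1⟩, 1, 6)
    | 18, 0 => (⟨2, r / 2 - 1⟩, 1, 5)
    | _, _ => (⟨4, 0⟩, 0, 0)

variable {h : ℕ}

set_option maxHeartbeats 1000000 in
theorem exists_blockDecode (hh : 5 ≤ h) {b : (_ : Fin 5) × ℕ} (hb : b.2 < blockCount h b.1)
    {p q : ℕ × ℕ} (hp : p ∈ blockMarks h b) (hq : q ∈ blockMarks h b) (hpq : p.1 < q.1) :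
    ∃ k r, r < 2 * h ∧ combDist p q + 2 = 2 * h * k + r ∧ (blockDecode h k r).1 = b ∧
      (blockMarks h b)[(blockDecode h k r).2.1]? = some p ∧
      (blockMarks h b)[(blockDecode h k r).2.2]? = some q := by
  rw [combDist_of_lt hpq]
  obtain ⟨kind, i⟩ := b
  have mod₁ : (2 * i + 1) % 2 = 1 := by omega
  have mod₂ : (2 * i + 2) % 2 = 0 := by omega
  have div₁ : (2 * i + 1) / 2 = i := by omega
  fin_cases kind
  · simp [blockMarks, blockCount] at hb hp hq
    obtain rfl | rfl := hp <;> obtain rfl | rfl := hq <;> simp at hpq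
    have hmod : (i + 3) % (2 * h) < 2 * h := Nat.mod_lt _ (by omega)
    have hdiv : (i + 3) / (2 * h) < 5 := Nat.div_lt_of_lt_mul (by omega)
    have hadd := Nat.div_add_mod (i + 3) (2 * h)
    refine ⟨(i + 3) / (2 * h), (i + 3) % (2 * h), hmod, by omega, ?_⟩
    simp [blockDecode, blockMarks, hdiv, hadd]
  · simp [blockMarks, blockCount] at hb hp hq
    obtain rfl | rfl := hp <;> obtain rfl | rfl := hq <;> simp at hpq
    refine ⟨5, 2 * i, by omega, by dsimp only; omega, ?_⟩
    simp [blockDecode, blockMarks]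
  · simp [blockMarks, blockCount] at hb hp hq
    rcases hp with rfl | rfl | rfl | rfl | rfl | rfl | rfl <;>
    rcases hq with rfl | rfl | rfl | rfl | rfl | rfl | rfl <;>
    simp only at hpq <;> try (exfalso; omega)
    · refine ⟨6, 2 * i + 1, by omega, by dsimp only; omega, ?_⟩
      simp [blockDecode, blockMarks, mod₁, div₁]
    · refine ⟨8, 2 * i + 1, by omega, by dsimp only; omega, ?_⟩
      simp [blockDecode, blockMarks, mod₁, div₁]
    · refine ⟨11, 2 * i, by omega, by dsimp only; omega, ?_⟩
      simp [blockDecode, blockMarks]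
    · refine ⟨14, 2 * i + 1, by omega, by dsimp only; omega, ?_⟩
      simp [blockDecode, blockMarks, mod₁, div₁]
    · refine ⟨16, 2 * i + 1, by omega, by dsimp only; omega, ?_⟩
      simp [blockDecode, blockMarks, mod₁, div₁]
    · refine ⟨15, 2 * i + 1, by omega, by dsimp only; omega, ?_⟩
      simp [blockDecode, blockMarks, mod₁, div₁]
    · refine ⟨10, 2 * i + 2, by omega, by dsimp only; omega, ?_⟩
      simp [blockDecode, blockMarks, mod₂]
    · refine ⟨13, 2 * i + 1, by omega, by dsimp only; omega, ?_⟩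
      simp [blockDecode, blockMarks, mod₁, div₁]
    · refine ⟨16, 2 * i + 2, by omega, by dsimp only; omega, ?_⟩
      simp [blockDecode, blockMarks, mod₂]
    · refine ⟨18, 2 * i + 2, by omega, by dsimp only; omega, ?_⟩
      simp [blockDecode, blockMarks, mod₂]
    · refine ⟨17, 2 * i + 2, by omega, by dsimp only; omega, ?_⟩
      simp [blockDecode, blockMarks, mod₂]
    · refine ⟨9, 2 * i + 1, by omega, by dsimp only; omega, ?_⟩
      simp [blockDecode, blockMarks, mod₁, div₁]
    · refine ⟨12, 2 * i + 2, by omega, by dsimp only; omega, ?_⟩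
      simp [blockDecode, blockMarks, mod₂]
    · refine ⟨14, 2 * i + 2, by omega, by dsimp only; omega, ?_⟩
      simp [blockDecode, blockMarks, mod₂]
    · refine ⟨13, 2 * i + 2, by omega, by dsimp only; omega, ?_⟩
      simp [blockDecode, blockMarks, mod₂]
    · refine ⟨10, 2 * i + 1, by omega, by dsimp only; omega, ?_⟩
      simp [blockDecode, blockMarks, mod₁, div₁]
    · refine ⟨12, 2 * i + 1, by omega, by dsimp only; omega, ?_⟩
      simp [blockDecode, blockMarks, mod₁, div₁]
    · refine ⟨11, 2 * i + 1, by omega, by dsimp only; omega, ?_⟩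
      simp [blockDecode, blockMarks, mod₁, div₁]
    · refine ⟨9, 2 * i + 2, by omega, by dsimp only; omega, ?_⟩
      simp [blockDecode, blockMarks, mod₂]
    · refine ⟨8, 2 * i + 2, by omega, by dsimp only; omega, ?_⟩
      simp [blockDecode, blockMarks, mod₂]
    · refine ⟨6, 2 * i + 2, by omega, by dsimp only; omega, ?_⟩
      simp [blockDecode, blockMarks, mod₂]
  · simp [blockMarks, blockCount] at hb hp hq
    rcases hp with rfl | rfl | rfl <;> rcases hq with rfl | rfl | rfl <;>
    simp only at hpq <;> try (exfalso; omega)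
    · refine ⟨7, 2 * i, by omega, by dsimp only; omega, ?_⟩
      simp [blockDecode, blockMarks]
    · refine ⟨7, 2 * i + 1, by omega, by dsimp only; omega, ?_⟩
      simp [blockDecode, blockMarks, mod₁, div₁]
    · refine ⟨5, 2 * i + 1, by omega, by dsimp only; omega, ?_⟩
      simp [blockDecode, blockMarks, mod₁, div₁]
  · simp [blockMarks] at hp

theorem eq_of_combDist_blockMarks (hh : 5 ≤ h) {b c : (_ : Fin 5) × ℕ}
    (hb : b.2 < blockCount h b.1) (hc : c.2 < blockCount h c.1) {p q p' q' : ℕ × ℕ}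
    (hp : p ∈ blockMarks h b) (hq : q ∈ blockMarks h b) (hp' : p' ∈ blockMarks h c)
    (hq' : q' ∈ blockMarks h c) (hpq : p.1 < q.1) (hpq' : p'.1 < q'.1)
    (heq : combDist p q = combDist p' q') : b = c ∧ p = p' ∧ q = q' := by
  obtain ⟨k, r, hr, hk, rfl, hpr, hqr⟩ := exists_blockDecode hh hb hp hq hpq
  obtain ⟨k', r', hr', hk', rfl, hpr', hqr'⟩ := exists_blockDecode hh hc hp' hq' hpq'
  have hkr : 2 * h * k + r = 2 * h * k' + r' := by rw [← hk, ← hk', heq]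
  obtain rfl : k = k' := by
    have := congrArg (· / (2 * h)) hkr
    simpa [Nat.mul_add_div (by omega : 2 * h > 0), Nat.div_eq_of_lt hr,
      Nat.div_eq_of_lt hr'] using this
  obtain rfl : r = r' := Nat.add_left_cancel hkr
  exact ⟨rfl, Option.some.inj (hpr.symm.trans hpr'), Option.some.inj (hqr.symm.trans hqr')⟩

theorem pairwise_blockMarks (hh : 5 ≤ h) (b : (_ : Fin 5) × ℕ) :
    (blockMarks h b).Pairwise fun p q => p.1 < q.1 := by
  obtain ⟨kind, i⟩ := b
  fin_cases kind <;> simp [blockMarks] <;> omega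

theorem lt_blockSpine (hh : 5 ≤ h) (f : ℕ) (b : (_ : Fin 5) × ℕ) {p : ℕ × ℕ}
    (hp : p ∈ blockMarks h b) : p.1 < blockSpine h f b := by
  obtain ⟨kind, i⟩ := b
  fin_cases kind <;> simp [blockMarks] at hp <;> simp [blockSpine]
  · rcases hp with rfl | rfl <;> simp
  · rcases hp with rfl | rfl <;> dsimp only <;> omega
  · rcases hp with rfl | rfl | rfl | rfl | rfl | rfl | rfl <;> dsimp only <;> omega
  · rcases hp with rfl | rfl | rfl <;> dsimp only <;> omega

theorem eq_of_mem_blockMarks (hh : 5 ≤ h) {b : (_ : Fin 5) × ℕ} {p q : ℕ × ℕ}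
    (hp : p ∈ blockMarks h b) (hq : q ∈ blockMarks h b) (hpq : p.1 = q.1) : p = q := by
  have : Std.Symm fun p q : ℕ × ℕ => p.1 ≠ q.1 := ⟨fun _ _ => Ne.symm⟩
  by_contra hne
  exact ((pairwise_blockMarks hh b).imp fun h => h.ne).forall hp hq hne hpq

theorem nodup_blockMarks (hh : 5 ≤ h) (b : (_ : Fin 5) × ℕ) : (blockMarks h b).Nodup :=
  (pairwise_blockMarks hh b).imp fun h => ne_of_apply_ne Prod.fst h.ne

/-- The vertices of each block. -/
def blockPart (h f : ℕ) (b : (_ : Fin 5) × ℕ) : Finset (ℕ × ℕ) :=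
  combPart (blockSpine h f b) (blockMarks h b).toFinset

theorem card_blockPart_le (hh : 5 ≤ h) (f : ℕ) (b : (_ : Fin 5) × ℕ) :
    (blockPart h f b).card ≤
      ![4 + 1 * b.2, 10 * h + 1 + 2 * b.2, 65 * h + 6 + 7 * b.2, 19 * h + 2 + 3 * b.2, f] b.1 := by
  refine (card_combPart_le _ _).trans ?_
  rw [List.sum_toFinset _ (nodup_blockMarks hh b)]
  obtain ⟨kind, i⟩ := b
  fin_cases kind <;> simp [blockMarks, blockSpine] <;> omega

theorem card_blockPart_four (h f i : ℕ) : (blockPart h f ⟨4, i⟩).card = f := by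
  simp [blockPart, combPart, blockSpine, blockMarks]

/-- The index set of the blocks. -/
def blocks (h : ℕ) : Finset ((_ : Fin 5) × ℕ) :=
  Finset.univ.sigma fun kind => Finset.range (blockCount h kind)

theorem mem_blocks {b : (_ : Fin 5) × ℕ} : b ∈ blocks h ↔ b.2 < blockCount h b.1 := by
  simp [blocks]

theorem card_blocks (hh : 5 ≤ h) : (blocks h).card = 13 * h - 4 := by
  simp [blocks, Fin.sum_univ_five, blockCount]
  omega

theorem sum_card_blockMarks (hh : 5 ≤ h) :
    ∑ b ∈ blocks h, (blockMarks h b).toFinset.card = 32 * h - 16 := by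
  simp_rw [List.toFinset_card_of_nodup (nodup_blockMarks hh _), blocks, Finset.sum_sigma,
    Fin.sum_univ_five]
  simp [blockCount, blockMarks]
  omega

theorem two_mul_sum_range_le (a c : ℕ) {m N : ℕ} (hm : m ≤ N) :
    2 * ∑ i ∈ Finset.range m, (a + c * i) ≤ 2 * a * N + c * N ^ 2 := by
  have : 2 * ∑ i ∈ Finset.range m, (a + c * i) ≤ 2 * a * m + c * m ^ 2 := by
    clear hm
    induction m with
    | zero => simp
    | succ m ih =>
      rw [Finset.sum_range_succ]
      nlinarith
  exact this.trans (by gcongr)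

theorem sum_card_blockPart (h f : ℕ) :
    ∑ b ∈ blocks h, (blockPart h f b).card = ∑ b ∈ blocks h, (blockPart h 0 b).card + f := by
  simp_rw [blocks, Finset.sum_sigma, Fin.sum_univ_five]
  simp [blockCount, card_blockPart_four]
  rfl

theorem sum_card_blockPart_le (hh : 5 ≤ h) :
    ∑ b ∈ blocks h, (blockPart h 0 b).card ≤ 150 * h ^ 2 + 49 * h := by
  refine (Finset.sum_le_sum fun b _ => card_blockPart_le hh 0 b).trans ?_
  simp_rw [blocks, Finset.sum_sigma, Fin.sum_univ_five]
  simp only [blockCount, Matrix.cons_val, Finset.range_one, Finset.sum_const_zero, add_zero]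
  have h₀ := two_mul_sum_range_le 4 1 (Nat.sub_le (10 * h) 3)
  have h₁ := two_mul_sum_range_le (10 * h + 1) 2 (le_refl h)
  have h₂ := two_mul_sum_range_le (65 * h + 6) 7 (Nat.sub_le h 1)
  have h₃ := two_mul_sum_range_le (19 * h + 2) 3 (Nat.sub_le h 1)
  nlinarith

end blocks

theorem le_maxEdges_blocks {h n : ℕ} (hh : 5 ≤ h) (hn : 150 * h ^ 2 + 49 * h + 1 ≤ n) :
    n + (19 * h - 13) ≤ maxEdges n := by
  have hle := sum_card_blockPart_le hh
  obtain ⟨f, hf⟩ : ∃ f, ∑ b ∈ blocks h, (blockPart h f b).card + 1 = n :=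
    ⟨n - 1 - ∑ b ∈ blocks h, (blockPart h 0 b).card, by rw [sum_card_blockPart]; omega⟩
  have := le_maxEdges_combs (M := fun b => (blockMarks h b).toFinset)
    (fun b _ => subset_combPart _ _)
    (fun b _ p hp => combParent_mem_combPart
      (fun m hm => lt_blockSpine hh f b (List.mem_toFinset.1 hm)) hp)
    (fun b _ p hp q hq hpq =>
      eq_of_mem_blockMarks hh (List.mem_toFinset.1 hp) (List.mem_toFinset.1 hq) hpq)
    (fun b hb c hc p hp q hq p' hp' q' hq' hpq hpq' heq =>
      eq_of_combDist_blockMarks hh (mem_blocks.1 hb) (mem_blocks.1 hc) (List.mem_toFinset.1 hp)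
        (List.mem_toFinset.1 hq) (List.mem_toFinset.1 hp') (List.mem_toFinset.1 hq') hpq hpq' heq)
    hf
  rw [sum_card_blockMarks hh, card_blocks hh] at this
  omega

theorem stmt0 (r t n : ℕ) (hr : 1 ≤ r) (ht : t = 1260 * r + 169)
    (hn : (540 * (t : ℚ) ^ 2 + 175811 / 2 * t + 7989 / 2 : ℚ) ≤ (n : ℚ)) :
    n + 36 * t ≤ maxEdges n := by
  have hn' : 1080 * t ^ 2 + 175811 * t + 7989 ≤ 2 * n := by
    have : (1080 * (t : ℚ) ^ 2 + 175811 * t + 7989 : ℚ) ≤ 2 * n := by linarith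
    exact_mod_cast this
  obtain ⟨h, hlow, hupp⟩ : ∃ h, 36 * t + 13 ≤ 19 * h ∧ 19 * h ≤ 36 * t + 31 :=
    ⟨(36 * t + 31) / 19, by omega, by omega⟩
  have := le_maxEdges_blocks (h := h) (n := n) (by omega) (by nlinarith)
  omega
end

section
/- Let G be a graph consisting of a cycle C, a vertex x on C, and d ≥ 1 paths P₁, …, P_d, each joining x to a vertex of C different from x, such that the paths P₁, …, P_d are internally disjoint from C, internally disjoint from each other, have pairwise distinct endpoints on C, and none of them is a single edge of C. Then G contains exactly (d+2 choose 2) distinct cycles, and every cycle of G passes through x. -/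
/-- The set of cycles of `G`, where a cycle (as a subgraph) is identified with its
edge set. -/
def cycleEdgeSets {V : Type*} (G : SimpleGraph V) : Set (Set (Sym2 V)) :=
  {s | ∃ (w : V) (c : G.Walk w w), c.IsCycle ∧ s = {e | e ∈ c.edges}}

namespace SimpleGraph

variable {V : Type*} {G : SimpleGraph V} {x : V}

/-- A graph is acyclic if its vertices can be ranked so that every vertex has at most one
neighbor of rank at most its own. -/
theorem isAcyclic_of_rank (f : V → ℕ)
    (h : ∀ v u u', G.Adj v u → G.Adj v u' → f u ≤ f v → f u' ≤ f v → u = u') :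
    G.IsAcyclic := by
  classical
  intro w c hc
  obtain ⟨v, hv, hmax⟩ := c.support.toFinset.exists_max_image f ⟨w, by simp⟩
  rw [List.mem_toFinset] at hv
  have hmax' : ∀ u ∈ (c.rotate v hv).support, f u ≤ f v := fun u hu =>
    hmax u (by simpa using hu)
  have hr := hc.rotate hv
  exact hr.snd_ne_penultimate <| h v _ _ (Walk.adj_snd hr.not_nil)
    (Walk.adj_penultimate hr.not_nil).symm
    (hmax' _ (Walk.getVert_mem_support _ _)) (hmax' _ (Walk.getVert_mem_support _ _))

theorem Walk.edges_subset_deleteIncidenceSet {a b : V} (p : G.Walk a b) (hx : x ∉ p.support) :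
    ∀ e ∈ p.edges, e ∈ (G.deleteIncidenceSet x).edgeSet := by
  intro e
  induction e with
  | h u v =>
    intro he
    refine deleteIncidenceSet_adj.2 ⟨p.adj_of_mem_edges he, ?_, ?_⟩
    · rintro rfl
      exact hx (p.fst_mem_support_of_mem_edges he)
    · rintro rfl
      exact hx (p.snd_mem_support_of_mem_edges he)

theorem Walk.IsCycle.mem_support_of_isAcyclic_deleteIncidenceSet
    (hG : (G.deleteIncidenceSet x).IsAcyclic) {w : V} {c : G.Walk w w} (hc : c.IsCycle) :
    x ∈ c.support := by
  by_contra hx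
  exact hG _ (hc.transfer (c.edges_subset_deleteIncidenceSet hx))

theorem Walk.notMem_support_of_deleteIncidenceSet {a b : V}
    (q : (G.deleteIncidenceSet x).Walk a b) (ha : a ≠ x) : x ∉ q.support := by
  induction q with
  | nil => simpa using ha.symm
  | cons h q ih =>
    rw [deleteIncidenceSet_adj] at h
    simpa [ha.symm] using ih h.2.2

/-- If every cycle of `G` passes through `x`, then a cycle of `G` consists of two edges at `x`
and a path of `G - x`. -/
theorem mem_cycleEdgeSets_iff (hG : (G.deleteIncidenceSet x).IsAcyclic) {s : Set (Sym2 V)} :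
    s ∈ cycleEdgeSets G ↔ ∃ u v, u ≠ v ∧ G.Adj x u ∧ G.Adj x v ∧
      ∃ q : (G.deleteIncidenceSet x).Walk v u, q.IsPath ∧
        s = {s(x, u), s(x, v)} ∪ {e | e ∈ q.edges} := by
  classical
  constructor
  · rintro ⟨w, c, hc, rfl⟩
    have hx := hc.mem_support_of_isAcyclic_deleteIncidenceSet hG
    have hr := hc.rotate hx
    have he : {e | e ∈ c.edges} = {e | e ∈ (c.rotate x hx).edges} := by
      ext e
      exact ((c.rotate_edges x hx).mem_iff).symm
    rw [he]
    generalize c.rotate x hx = c' at hr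
    cases c' with
    | nil => simp at hr
    | @cons _ u _ h p =>
      rw [Walk.cons_isCycle_iff] at hr
      obtain ⟨hp, hxu⟩ := hr
      rw [← Walk.isPath_reverse_iff] at hp
      have hpe : ∀ e, e ∈ p.edges ↔ e ∈ p.reverse.edges := by simp
      simp only [Walk.edges_cons, List.mem_cons, hpe] at hxu ⊢
      generalize p.reverse = r at hp hxu
      cases r with
      | nil => exact absurd h (G.loopless.irrefl _)
      | @cons _ v _ h' q =>
        rw [Walk.cons_isPath_iff] at hp
        simp only [Walk.edges_cons, List.mem_cons, not_or] at hxu ⊢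
        have hE := q.edges_subset_deleteIncidenceSet hp.2
        refine ⟨u, v, ?_, h, h', q.transfer _ hE, hp.1.transfer hE, ?_⟩
        · rintro rfl
          exact hxu.1 rfl
        · ext e
          simp [or_assoc]
  · rintro ⟨u, v, huv, hu, hv, q, hq, rfl⟩
    have hxq := q.notMem_support_of_deleteIncidenceSet hv.ne'
    refine ⟨x, .cons hu (Walk.cons hv (q.mapLe (G.deleteIncidenceSet_le x))).reverse, ?_, ?_⟩
    · rw [Walk.cons_isCycle_iff, Walk.isPath_reverse_iff, Walk.cons_isPath_iff]
      refine ⟨⟨hq.mapLe _, by simpa using hxq⟩, ?_⟩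
      simp only [Walk.edges_reverse, Walk.edges_cons, Walk.edges_mapLe_eq_edges, List.mem_reverse,
        List.mem_cons, not_or]
      refine ⟨by simp [huv, hv.ne], fun h => hxq (q.fst_mem_support_of_mem_edges h)⟩
    · ext e
      simp [or_assoc, or_comm, Sym2.eq_swap (a := v)]

/-- If `G - x` is acyclic and connects all neighbors of `x`, then the cycles of `G` correspond to
the pairs of neighbors of `x`. -/
theorem ncard_cycleEdgeSets (hG : (G.deleteIncidenceSet x).IsAcyclic)
    (hconn : ∀ u v, G.Adj x u → G.Adj x v → (G.deleteIncidenceSet x).Reachable u v)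
    (hfin : (G.neighborSet x).Finite) :
    (cycleEdgeSets G).ncard = (G.neighborSet x).ncard.choose 2 := by
  classical
  have key : ∀ (u v : V) (q : (G.deleteIncidenceSet x).Walk v u), G.Adj x u → G.Adj x v →
      {w | s(x, w) ∈ ({s(x, u), s(x, v)} ∪ {e | e ∈ q.edges} : Set (Sym2 V))} = {u, v} := by
    intro u v q hu hv
    have hxq : ∀ w, s(x, w) ∉ q.edges := fun w h =>
      q.notMem_support_of_deleteIncidenceSet hv.ne' (q.fst_mem_support_of_mem_edges h)
    ext w
    simp only [Set.mem_union, Set.mem_insert_iff, Set.mem_singleton_iff, Set.mem_ofPred_eq, hxq,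
      or_false, Sym2.congr_right]
  rw [← Set.ncard_powerset_ncard hfin]
  refine Set.ncard_congr (fun s _ => {w | s(x, w) ∈ s}) ?_ ?_ ?_
  · intro s hs
    obtain ⟨u, v, huv, hu, hv, q, hq, rfl⟩ := (mem_cycleEdgeSets_iff hG).1 hs
    rw [key u v q hu hv]
    refine ⟨?_, Set.ncard_pair huv⟩
    rintro w (rfl | rfl) <;> assumption
  · intro s t hs ht hst
    obtain ⟨u, v, huv, hu, hv, q, hq, rfl⟩ := (mem_cycleEdgeSets_iff hG).1 hs
    obtain ⟨u', v', huv', hu', hv', q', hq', rfl⟩ := (mem_cycleEdgeSets_iff hG).1 ht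
    rw [key u v q hu hv, key u' v' q' hu' hv', Set.pair_eq_pair_iff] at hst
    obtain ⟨rfl, rfl⟩ | ⟨rfl, rfl⟩ := hst
    · have := congrArg Subtype.val ((hG.subsingleton_path _ _).elim ⟨q, hq⟩ ⟨q', hq'⟩)
      simp only at this
      rw [this]
    · have := congrArg Subtype.val ((hG.subsingleton_path _ _).elim ⟨q, hq⟩ ⟨q'.reverse, hq'.reverse⟩)
      simp only at this
      rw [this, Set.pair_comm]
      simp
  · rintro t ⟨htN, ht⟩
    obtain ⟨u, v, huv, rfl⟩ := Set.ncard_eq_two.1 ht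
    have hu : G.Adj x u := htN (by simp)
    have hv : G.Adj x v := htN (by simp)
    obtain ⟨q, hq⟩ := (hconn v u hv hu).exists_isPath
    exact ⟨_, (mem_cycleEdgeSets_iff hG).2 ⟨u, v, huv, hu, hv, q, hq, rfl⟩, key u v q hu hv⟩

end SimpleGraph

/-- A graph consisting of a cycle `C` through a vertex `x` together with `d ≥ 1` paths
from `x` to pairwise distinct vertices of `C` different from `x`, the paths being
internally disjoint from `C` and from each other, none of them being a single edge of
`C`, contains exactly `(d+2).choose 2` cycles, and every cycle passes through `x`. -/
theorem stmt4 {V : Type*} (G : SimpleGraph V) (x : V) (C : G.Walk x x)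
    (hC : C.IsCycle) (d : ℕ) (hd : 1 ≤ d)
    (y : Fin d → V) (P : (j : Fin d) → G.Walk x (y j))
    (hyx : ∀ j, y j ≠ x) (hyC : ∀ j, y j ∈ C.support)
    (hyinj : Function.Injective y)
    (hP : ∀ j, (P j).IsPath)
    (hPC : ∀ j, ∀ w : V, w ∈ (P j).support → w ∈ C.support → w = x ∨ w = y j)
    (hPP : ∀ j j', j ≠ j' → ∀ w : V, w ∈ (P j).support → w ∈ (P j').support → w = x)
    (hPnotchordedge : ∀ j, (P j).length = 1 → s(x, y j) ∉ C.edges)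
    (hG : G.edgeSet = {e | e ∈ C.edges} ∪ ⋃ j, {e | e ∈ (P j).edges}) :
    (cycleEdgeSets G).ncard = (d + 2).choose 2 ∧
      ∀ (w : V) (c : G.Walk w w), c.IsCycle → x ∈ c.support := by
  classical
  have hn := hC.three_le_length
  set n := C.length with hn_def
  have hcx : ∀ i, i ≤ n → C.getVert i = x → i = 0 ∨ i = n := fun i hi h =>
    (hC.getVert_endpoint_iff hi).1 h
  have hcinj : ∀ i i', 1 ≤ i → i ≤ n → 1 ≤ i' → i' ≤ n → C.getVert i = C.getVert i' → i = i' :=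
    fun i i' h1 h2 h3 h4 h => hC.getVert_injOn ⟨h1, h2⟩ ⟨h3, h4⟩ h
  have hC0 : C.getVert 0 = x := C.getVert_zero
  have hCn : C.getVert n = x := C.getVert_length
  have hP0 : ∀ j, (P j).getVert 0 = x := fun j => (P j).getVert_zero
  have hPl : ∀ j, (P j).getVert (P j).length = y j := fun j => (P j).getVert_length
  have hpinj : ∀ j i i', i ≤ (P j).length → i' ≤ (P j).length →
      (P j).getVert i = (P j).getVert i' → i = i' :=
    fun j i i' h1 h2 h => (hP j).getVert_injOn h1 h2 h
  have hpx : ∀ j i, i ≤ (P j).length → (P j).getVert i = x → i = 0 := fun j i hi h =>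
    hpinj j i 0 hi (Nat.zero_le _) (h.trans (hP0 j).symm)
  have hL : ∀ j, 1 ≤ (P j).length := by
    intro j
    by_contra h
    exact hyx j (by rw [← hPl j, show (P j).length = 0 by omega, hP0])
  -- interior vertices of the paths avoid `C`
  have hpC : ∀ j i, 1 ≤ i → i < (P j).length → (P j).getVert i ∉ C.support := by
    intro j i h1 h2 h
    rcases hPC j _ ((P j).getVert_mem_support i) h with h | h
    · have := hpx j i h2.le h
      omega
    · have := hpinj j i _ h2.le le_rfl (h.trans (hPl j).symm)
      omega
  have hpp : ∀ j j' i i', 1 ≤ i → i ≤ (P j).length → (P j).getVert i = (P j').getVert i' →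
      j = j' := by
    intro j j' i i' h1 h2 h
    by_contra hjj
    have := hpx j i h2 (hPP j j' hjj _ ((P j).getVert_mem_support i)
      (h ▸ (P j').getVert_mem_support i'))
    omega
  have hyc : ∀ j, ∃ k, 1 ≤ k ∧ k < n ∧ C.getVert k = (P j).getVert (P j).length := by
    intro j
    rw [hPl]
    obtain ⟨k, hk, hkn⟩ := SimpleGraph.Walk.mem_support_iff_exists_getVert.1 (hyC j)
    have h0 : k ≠ 0 := by
      rintro rfl
      exact hyx j (hk.symm.trans hC0)
    have h1 : k ≠ n := by
      rintro rfl
      exact hyx j (hk.symm.trans hCn)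
    exact ⟨k, by omega, by omega, hk⟩
  have hadj : ∀ u v, G.Adj u v ↔ (∃ i < n, s(C.getVert i, C.getVert (i + 1)) = s(u, v)) ∨
      ∃ j, ∃ i < (P j).length, s((P j).getVert i, (P j).getVert (i + 1)) = s(u, v) := by
    intro u v
    rw [← SimpleGraph.mem_edgeSet, hG]
    simp [SimpleGraph.Walk.mk_mem_edges_iff_exists, hn_def]
  -- rank the vertices of `C` in order, and those of the paths by distance to `C`
  obtain ⟨f, hfC, hfP⟩ : ∃ f : V → ℕ, (∀ i, 1 ≤ i → i < n → f (C.getVert i) = i) ∧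
      ∀ j i, 1 ≤ i → i < (P j).length → f ((P j).getVert i) = n + ((P j).length - i) := by
    let f : V → ℕ := fun v =>
      if h : ∃ i, 1 ≤ i ∧ i < n ∧ C.getVert i = v then h.choose
      else if h : ∃ ji : Fin d × ℕ, 1 ≤ ji.2 ∧ ji.2 < (P ji.1).length ∧ (P ji.1).getVert ji.2 = v
        then n + ((P h.choose.1).length - h.choose.2)
      else 0
    refine ⟨f, ?_, ?_⟩
    · intro i h1 h2
      have h : ∃ k, 1 ≤ k ∧ k < n ∧ C.getVert k = C.getVert i := ⟨i, h1, h2, rfl⟩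
      obtain ⟨h3, h4, h5⟩ := h.choose_spec
      simp only [f, dif_pos h]
      exact hcinj _ _ h3 h4.le h1 h2.le h5
    · intro j i h1 h2
      have h : ¬ ∃ k, 1 ≤ k ∧ k < n ∧ C.getVert k = (P j).getVert i := by
        rintro ⟨k, -, -, hk⟩
        exact hpC j i h1 h2 (hk ▸ C.getVert_mem_support k)
      have h' : ∃ ji : Fin d × ℕ, 1 ≤ ji.2 ∧ ji.2 < (P ji.1).length ∧
          (P ji.1).getVert ji.2 = (P j).getVert i := ⟨(j, i), h1, h2, rfl⟩
      obtain ⟨h3, h4, h5⟩ := h'.choose_spec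
      simp only [f, dif_neg h, dif_pos h']
      generalize h'.choose = ji at h3 h4 h5
      obtain ⟨j', i'⟩ := ji
      obtain rfl := hpp _ _ _ _ h3 h4.le h5
      rw [hpinj _ _ _ h4.le h2.le h5]
  have hdown : ∀ v u, (G.deleteIncidenceSet x).Adj v u → f u ≤ f v →
      (∃ i, 1 ≤ i ∧ i + 1 < n ∧ u = C.getVert i ∧ v = C.getVert (i + 1)) ∨
      ∃ j i, 1 ≤ i ∧ i < (P j).length ∧ v = (P j).getVert i ∧ u = (P j).getVert (i + 1) := by
    intro v u h hf
    rw [SimpleGraph.deleteIncidenceSet_adj, hadj] at h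
    obtain ⟨⟨i, hi, h⟩ | ⟨j, i, hi, h⟩, hv, hu⟩ := h
    · rw [Sym2.eq_iff] at h
      have hi0 : i ≠ 0 := by
        rintro rfl
        grind
      have hin : i + 1 ≠ n := by
        intro hin
        rw [hin] at h
        grind
      obtain ⟨rfl, rfl⟩ | ⟨rfl, rfl⟩ := h
      · rw [hfC i (by omega) hi, hfC (i + 1) (by omega) (by omega)] at hf
        omega
      · exact .inl ⟨i, by omega, by omega, rfl, rfl⟩
    · rw [Sym2.eq_iff] at h
      have hi0 : i ≠ 0 := by
        rintro rfl
        grind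
      obtain ⟨rfl, rfl⟩ | ⟨rfl, rfl⟩ := h
      · exact .inr ⟨j, i, by omega, hi, rfl, rfl⟩
      · rw [hfP j i (by omega) hi] at hf
        obtain hl | hl : i + 1 = (P j).length ∨ i + 1 < (P j).length := by omega
        · obtain ⟨k, hk1, hk2, hk⟩ := hyc j
          rw [hl, ← hk, hfC k hk1 hk2] at hf
          omega
        · rw [hfP j (i + 1) (by omega) hl] at hf
          omega
  have hac : (G.deleteIncidenceSet x).IsAcyclic := by
    refine SimpleGraph.isAcyclic_of_rank f fun v u u' h h' hf hf' => ?_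
    obtain ⟨i, h1, h2, rfl, hv⟩ | ⟨j, i, h1, h2, hv, rfl⟩ := hdown v u h hf <;>
      obtain ⟨i', h1', h2', rfl, hv'⟩ | ⟨j', i', h1', h2', hv', rfl⟩ := hdown v u' h' hf'
    · have := hcinj _ _ (by omega) h2.le (by omega) h2'.le (hv.symm.trans hv')
      rw [Nat.succ_injective this]
    · exact absurd (hv'.symm.trans hv ▸ C.getVert_mem_support _) (hpC j' i' h1' h2')
    · exact absurd (hv.symm.trans hv' ▸ C.getVert_mem_support _) (hpC j i h1 h2)
    · obtain rfl := hpp _ _ _ _ h1 h2.le (hv.symm.trans hv')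
      rw [hpinj _ _ _ h2.le h2'.le (hv.symm.trans hv')]
  have hreachC : ∀ i, 1 ≤ i → i < n →
      (G.deleteIncidenceSet x).Reachable (C.getVert 1) (C.getVert i) := by
    intro i h1
    induction i, h1 using Nat.le_induction with
    | base => exact fun _ => .rfl
    | succ i h1 ih =>
      intro hi
      refine (ih (by omega)).trans (SimpleGraph.Adj.reachable ?_)
      refine SimpleGraph.deleteIncidenceSet_adj.2 ⟨C.adj_getVert_succ (by omega), ?_, ?_⟩
      · intro h
        have := hcx _ (by omega) h
        omega
      · intro h
        have := hcx _ (by omega) h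
        omega
  have hreachP : ∀ j i, 1 ≤ i → i ≤ (P j).length →
      (G.deleteIncidenceSet x).Reachable ((P j).getVert 1) ((P j).getVert i) := by
    intro j i h1
    induction i, h1 using Nat.le_induction with
    | base => exact fun _ => .rfl
    | succ i h1 ih =>
      intro hi
      refine (ih (by omega)).trans (SimpleGraph.Adj.reachable ?_)
      refine SimpleGraph.deleteIncidenceSet_adj.2 ⟨(P j).adj_getVert_succ (by omega), ?_, ?_⟩
      · intro h
        have := hpx _ _ (by omega) h
        omega
      · intro h
        have := hpx _ _ (by omega) h
        omega
  have hN : G.neighborSet x =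
      insert (C.getVert 1) (insert (C.getVert (n - 1)) (Set.range fun j => (P j).getVert 1)) := by
    ext w
    rw [SimpleGraph.mem_neighborSet, hadj]
    simp only [Set.mem_insert_iff, Set.mem_range]
    constructor
    · rintro (⟨i, hi, h⟩ | ⟨j, i, hi, h⟩)
      · rw [Sym2.eq_iff] at h
        obtain ⟨h, rfl⟩ | ⟨rfl, h⟩ := h
        · obtain rfl : i = 0 := by
            have := hcx i hi.le h
            omega
          exact .inl rfl
        · obtain rfl : i = n - 1 := by
            have := hcx (i + 1) hi h
            omega
          exact .inr (.inl rfl)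
      · rw [Sym2.eq_iff] at h
        obtain ⟨h, rfl⟩ | ⟨rfl, h⟩ := h
        · obtain rfl := hpx j i hi.le h
          exact .inr (.inr ⟨j, rfl⟩)
        · have := hpx j (i + 1) hi h
          omega
    · rintro (rfl | rfl | ⟨j, rfl⟩)
      · exact .inl ⟨0, by omega, by rw [hC0]⟩
      · refine .inl ⟨n - 1, by omega, ?_⟩
        rw [show n - 1 + 1 = n by omega, hCn, Sym2.eq_swap]
      · exact .inr ⟨j, 0, hL j, by rw [hP0]⟩
  have hreach : ∀ u, G.Adj x u → (G.deleteIncidenceSet x).Reachable (C.getVert 1) u := by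
    intro u hu
    rw [← SimpleGraph.mem_neighborSet, hN] at hu
    obtain rfl | rfl | ⟨j, rfl⟩ := hu
    · rfl
    · exact hreachC _ (by omega) (by omega)
    · obtain ⟨k, hk1, hk2, hk⟩ := hyc j
      have h := hreachP j _ (hL j) le_rfl
      rw [← hk] at h
      exact (hreachC k hk1 hk2).trans h.symm
  have hfirst : ∀ j, s(x, (P j).getVert 1) ∉ C.edges := by
    intro j h
    obtain hl | hl : (P j).length = 1 ∨ 1 < (P j).length := by
      have := hL j
      omega
    · exact hPnotchordedge j hl (by rwa [← hPl j, hl])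
    · exact hpC j 1 le_rfl hl (C.snd_mem_support_of_mem_edges h)
  have hcard : (G.neighborSet x).ncard = d + 2 := by
    have hinj : Function.Injective fun j => (P j).getVert 1 := fun j j' h =>
      hpp j j' 1 1 le_rfl (hL j) h
    have h1 : C.getVert (n - 1) ∉ Set.range fun j => (P j).getVert 1 := by
      rintro ⟨j, hj⟩
      refine hfirst j (C.mk_mem_edges_iff_exists.2 ⟨n - 1, by omega, ?_⟩)
      rw [show n - 1 + 1 = n by omega, hCn, Sym2.eq_swap, ← hj]
    have h2 : C.getVert 1 ∉ insert (C.getVert (n - 1)) (Set.range fun j => (P j).getVert 1) := by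
      rintro (h | ⟨j, hj⟩)
      · have := hcinj _ _ le_rfl (by omega) (by omega) (by omega) h
        omega
      · refine hfirst j (C.mk_mem_edges_iff_exists.2 ⟨0, by omega, ?_⟩)
        rw [hC0, ← hj]
    rw [hN, Set.ncard_insert_of_notMem h2, Set.ncard_insert_of_notMem h1,
      Set.ncard_range_of_injective hinj, Nat.card_eq_fintype_card, Fintype.card_fin]
  have hfin : (G.neighborSet x).Finite := Set.finite_of_ncard_ne_zero (by omega)
  refine ⟨?_, fun w c hc => hc.mem_support_of_isAcyclic_deleteIncidenceSet hac⟩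
  rw [SimpleGraph.ncard_cycleEdgeSets hac
    (fun u v hu hv => (hreach u hu).symm.trans (hreach v hv)) hfin, hcard]
end

section
/- Let t = 1260r + 169 with r ≥ 1 and let i be an integer with 58 ≤ i ≤ t − 742. Let B be the graph consisting of a cycle x y¹ y² … y^{132t+11i+893} x of length 132t + 11i + 894 through a vertex x, together with ten paths from x, internally disjoint from the cycle and from each other, of lengths (17t+1)/2, (19t+1)/2, (19t+1)/2, (21t+1)/2, (21t+1)/2, (23t+1)/2, (23t+1)/2, (25t+1)/2, (25t+1)/2, (27t+1)/2 respectively, ending at the cycle vertices y^{(37t−115)/2+i}, y^{(57t−103)/2+2i}, y^{(77t+315)/2+3i}, y^{(97t+313)/2+4i}, y^{(117t+313)/2+5i}, y^{(137t+311)/2+6i}, y^{(157t+309)/2+7i}, y^{(177t+297)/2+8i}, y^{(197t+301)/2+9i}, y^{(217t+305)/2+10i} respectively. Then B contains exactly 66 distinct cycles, and the multiset of their lengths is {27t+i−57, 28t+i+7, 29t+i+210, 30t+i, 31t+i+1, 32t+i, 33t+i, 34t+i−5, 35t+i+3, 36t+i+3, 37t+i+742, 38t+2i−51, 38t+2i+216,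 40t+2i+209, 40t+2i, 42t+2i, 42t+2i−1, 44t+2i−6, 44t+2i−3, 46t+2i+5, 46t+2i+744, 48t+3i+158, 49t+3i+215, 50t+3i+209, 51t+3i−1, 52t+3i−1, 53t+3i−7, 54t+3i−4, 55t+3i−1, 56t+3i+746, 59t+4i+157, 59t+4i+215, 61t+4i+208, 61t+4i−2, 63t+4i−7, 63t+4i−5, 65t+4i−2, 65t+4i+740, 69t+5i+157, 70t+5i+214, 71t+5i+207, 72t+5i−8, 73t+5i−5, 74t+5i−3, 75t+5i+739, 80t+6i+156, 80t+6i+213, 82t+6i+201, 82t+6i−6, 84t+6i−3, 84t+6i+738, 90t+7i+155, 91t+7i+207, 92t+7i+203, 93t+7i−4, 94t+7i+738, 101t+8i+149, 101t+8i+209, 103t+8i+205, 103t+8i+737, 111t+9i+151, 112t+9i+211, 113t+9i+946, 122t+10i+153, 122t+10i+952, 132t+11i+894}. -/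
/-- The lengths of the ten paths attached at `x` in the construction. -/
def pathLen (t : ℕ) : Fin 10 → ℕ :=
  ![(17 * t + 1) / 2, (19 * t + 1) / 2, (19 * t + 1) / 2, (21 * t + 1) / 2,
    (21 * t + 1) / 2, (23 * t + 1) / 2, (23 * t + 1) / 2, (25 * t + 1) / 2,
    (25 * t + 1) / 2, (27 * t + 1) / 2]

/-- The indices along the cycle of the attachment vertices of the ten paths. -/
def attachIdx (t i : ℕ) : Fin 10 → ℕ :=
  ![(37 * t - 115) / 2 + i, (57 * t - 103) / 2 + 2 * i, (77 * t + 315) / 2 + 3 * i,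
    (97 * t + 313) / 2 + 4 * i, (117 * t + 313) / 2 + 5 * i, (137 * t + 311) / 2 + 6 * i,
    (157 * t + 309) / 2 + 7 * i, (177 * t + 297) / 2 + 8 * i, (197 * t + 301) / 2 + 9 * i,
    (217 * t + 305) / 2 + 10 * i]

/-- The multiset of the 66 cycle lengths of the subgraph `B_{27t+i-57}`. -/
def cycleLengths (t i : ℕ) : Multiset ℕ :=
  {27 * t + i - 57, 28 * t + i + 7, 29 * t + i + 210, 30 * t + i,
   31 * t + i + 1, 32 * t + i, 33 * t + i, 34 * t + i - 5,
   35 * t + i + 3, 36 * t + i + 3, 37 * t + i + 742, 38 * t + 2 * i - 51,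
   38 * t + 2 * i + 216, 40 * t + 2 * i + 209, 40 * t + 2 * i, 42 * t + 2 * i,
   42 * t + 2 * i - 1, 44 * t + 2 * i - 6, 44 * t + 2 * i - 3, 46 * t + 2 * i + 5,
   46 * t + 2 * i + 744, 48 * t + 3 * i + 158, 49 * t + 3 * i + 215, 50 * t + 3 * i + 209,
   51 * t + 3 * i - 1, 52 * t + 3 * i - 1, 53 * t + 3 * i - 7, 54 * t + 3 * i - 4,
   55 * t + 3 * i - 1, 56 * t + 3 * i + 746, 59 * t + 4 * i + 157, 59 * t + 4 * i + 215,
   61 * t + 4 * i + 208, 61 * t + 4 * i - 2, 63 * t + 4 * i - 7, 63 * t + 4 * i - 5,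
   65 * t + 4 * i - 2, 65 * t + 4 * i + 740, 69 * t + 5 * i + 157, 70 * t + 5 * i + 214,
   71 * t + 5 * i + 207, 72 * t + 5 * i - 8, 73 * t + 5 * i - 5, 74 * t + 5 * i - 3,
   75 * t + 5 * i + 739, 80 * t + 6 * i + 156, 80 * t + 6 * i + 213, 82 * t + 6 * i + 201,
   82 * t + 6 * i - 6, 84 * t + 6 * i - 3, 84 * t + 6 * i + 738, 90 * t + 7 * i + 155,
   91 * t + 7 * i + 207, 92 * t + 7 * i + 203, 93 * t + 7 * i - 4, 94 * t + 7 * i + 738,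
   101 * t + 8 * i + 149, 101 * t + 8 * i + 209, 103 * t + 8 * i + 205, 103 * t + 8 * i + 737,
   111 * t + 9 * i + 151, 112 * t + 9 * i + 211, 113 * t + 9 * i + 946, 122 * t + 10 * i + 153,
   122 * t + 10 * i + 952, 132 * t + 11 * i + 894}

open SimpleGraph in
/-- A function whose consecutive values are adjacent traces out a walk. -/
theorem exists_walk_of_adj {V : Type*} {G : SimpleGraph V} (f : ℕ → V) (N : ℕ)
    (h : ∀ m < N, G.Adj (f m) (f (m + 1))) :
    ∃ p : G.Walk (f 0) (f N), p.support = (List.range (N + 1)).map f ∧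
      p.edges = (List.range N).map fun m ↦ s(f m, f (m + 1)) := by
  induction N with
  | zero => exact ⟨Walk.nil, by simp, by simp⟩
  | succ N ih =>
    obtain ⟨p, hs, he⟩ := ih fun m hm ↦ h m (by omega)
    refine ⟨p.concat (h N (by omega)), ?_, ?_⟩
    · rw [Walk.support_concat, hs, List.range_succ (n := N + 1)]
      simp
    · rw [Walk.edges_concat, he, List.range_succ (n := N)]
      simp

/-- If a predicate holds nowhere or at exactly two points, it holds at both or neither of any
two points that contain its support. -/
theorem iff_of_forall_not_or_exists_pair {V : Type*} {D : V → Prop}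
    (h : (∀ w, ¬D w) ∨ ∃ a b, a ≠ b ∧ ∀ w, D w ↔ w = a ∨ w = b) {p q : V}
    (hD : ∀ w, D w → w = p ∨ w = q) : D p ↔ D q := by
  rcases h with h | ⟨a, b, hab, h⟩
  · simp [h]
  · have ha := hD a ((h a).2 (Or.inl rfl))
    have hb := hD b ((h b).2 (Or.inr rfl))
    grind

/-- If a predicate holds nowhere or at exactly two points, it holds at an even number of any
three points that contain its support. -/
theorem xor_iff_of_forall_not_or_exists_pair {V : Type*} {D : V → Prop}
    (h : (∀ w, ¬D w) ∨ ∃ a b, a ≠ b ∧ ∀ w, D w ↔ w = a ∨ w = b) {p q r : V} (hpq : p ≠ q)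
    (hrp : r ≠ p) (hrq : r ≠ q) (hD : ∀ w, D w → w = p ∨ w = q ∨ w = r) :
    Xor (D p) (D r) ↔ D q := by
  simp only [Xor]
  rcases h with h | ⟨a, b, hab, h⟩
  · simp [h]
  · have ha := hD a ((h a).2 (Or.inl rfl))
    have hb := hD b ((h b).2 (Or.inr rfl))
    grind

open SimpleGraph in
/-- A cycle has no edge or exactly two edges at each vertex. -/
theorem SimpleGraph.Walk.IsCycle.forall_notMem_or_exists_pair {V : Type*} {G : SimpleGraph V}
    {u : V} {c : G.Walk u u} (hc : c.IsCycle) (v : V) :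
    (∀ w, s(v, w) ∉ c.edges) ∨ ∃ a b, a ≠ b ∧ ∀ w, s(v, w) ∈ c.edges ↔ w = a ∨ w = b := by
  by_cases hv : v ∈ c.support
  · obtain ⟨a, b, hab, h⟩ := Set.ncard_eq_two.1 (hc.ncard_neighborSet_toSubgraph_eq_two hv)
    refine Or.inr ⟨a, b, hab, fun w ↦ ?_⟩
    rw [← Walk.mem_edges_toSubgraph, Subgraph.mem_edgeSet, ← Subgraph.mem_neighborSet, h]
    simp
  · exact Or.inl fun w hw ↦ hv (c.fst_mem_support_of_mem_edges hw)

/-- A walk of length at least three that repeats no vertex after its first one is a cycle. -/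
theorem SimpleGraph.Walk.isCycle_of_nodup_tail_support {V : Type*} {G : SimpleGraph V} {u : V}
    {c : G.Walk u u} (hc : c.support.tail.Nodup) (h3 : 3 ≤ c.length) : c.IsCycle := by
  rw [isCycle_iff_isPath_tail_and_le_length]
  refine ⟨?_, h3⟩
  cases c with
  | nil => simp at h3
  | cons h p => simpa [isPath_def] using hc

/-- A graph presented as a closed rim through a hub, together with spokes from the hub to the rim.
The two extreme spokes are trivial: they stand for the two ends of the rim at the hub. -/
structure Fan {V : Type*} (G : SimpleGraph V) (n : ℕ) where
  hub : V
  rimLen : ℕ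
  rim : ℕ → V
  pos : Fin (n + 1) → ℕ
  spokeLen : Fin (n + 1) → ℕ
  spoke : Fin (n + 1) → ℕ → V
  three_le_rimLen : 3 ≤ rimLen
  pos_strictMono : StrictMono pos
  pos_zero : pos 0 = 0
  pos_last : pos (Fin.last n) = rimLen
  spokeLen_zero : spokeLen 0 = 0
  spokeLen_last : spokeLen (Fin.last n) = 0
  two_le_spokeLen : ∀ j, j ≠ 0 → j ≠ Fin.last n → 2 ≤ spokeLen j
  rim_zero : rim 0 = hub
  rim_rimLen : rim rimLen = hub
  spoke_zero : ∀ j, spoke j 0 = hub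
  spoke_spokeLen : ∀ j, spoke j (spokeLen j) = rim (pos j)
  rim_inj : ∀ {k k'}, k ≤ rimLen → k' ≤ rimLen → rim k = rim k' →
    k = k' ∨ (k = 0 ∧ k' = rimLen) ∨ (k = rimLen ∧ k' = 0)
  spoke_inj : ∀ {j m j' m'}, m ≤ spokeLen j → m' ≤ spokeLen j' → spoke j m = spoke j' m' →
    (m = 0 ∧ m' = 0) ∨ (j = j' ∧ m = m')
  spoke_eq_rim : ∀ {j m k}, m ≤ spokeLen j → k ≤ rimLen → spoke j m = rim k →
    (m = 0 ∧ (k = 0 ∨ k = rimLen)) ∨ (m = spokeLen j ∧ k = pos j)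
  mem_edgeSet : ∀ e, e ∈ G.edgeSet ↔ (∃ m < rimLen, e = s(rim m, rim (m + 1))) ∨
    ∃ j, ∃ m < spokeLen j, e = s(spoke j m, spoke j (m + 1))

namespace Fan

variable {V : Type*} {G : SimpleGraph V} {n : ℕ} (F : Fan G n)

theorem pos_le (j : Fin (n + 1)) : F.pos j ≤ F.rimLen :=
  F.pos_last ▸ F.pos_strictMono.monotone (Fin.le_last j)

theorem pos_inj {j k : Fin (n + 1)} : F.pos j = F.pos k ↔ j = k :=
  F.pos_strictMono.injective.eq_iff

theorem pos_pos {j : Fin (n + 1)} (hj : j ≠ 0) : 0 < F.pos j :=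
  F.pos_zero ▸ F.pos_strictMono (Fin.pos_iff_ne_zero.2 hj)

theorem pos_lt {j : Fin (n + 1)} (hj : j ≠ Fin.last n) : F.pos j < F.rimLen :=
  F.pos_last ▸ F.pos_strictMono (Fin.lt_last_iff_ne_last.2 hj)

theorem two_le_spokeLen_of_lt {j : Fin (n + 1)} {m : ℕ} (h : m < F.spokeLen j) :
    2 ≤ F.spokeLen j ∧ 0 < F.pos j ∧ F.pos j < F.rimLen := by
  have h0 : j ≠ 0 := by rintro rfl; simp [F.spokeLen_zero] at h
  have h1 : j ≠ Fin.last n := by rintro rfl; simp [F.spokeLen_last] at h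
  exact ⟨F.two_le_spokeLen j h0 h1, F.pos_pos h0, F.pos_lt h1⟩

theorem adj_rim {m : ℕ} (h : m < F.rimLen) : G.Adj (F.rim m) (F.rim (m + 1)) := by
  rw [← SimpleGraph.mem_edgeSet, F.mem_edgeSet]
  exact Or.inl ⟨m, h, rfl⟩

theorem adj_spoke {j : Fin (n + 1)} {m : ℕ} (h : m < F.spokeLen j) :
    G.Adj (F.spoke j m) (F.spoke j (m + 1)) := by
  rw [← SimpleGraph.mem_edgeSet, F.mem_edgeSet]
  exact Or.inr ⟨j, m, h, rfl⟩

theorem adj_cases {v w : V} (h : G.Adj v w) :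
    (∃ m < F.rimLen, (v = F.rim m ∧ w = F.rim (m + 1)) ∨ (v = F.rim (m + 1) ∧ w = F.rim m)) ∨
    ∃ j, ∃ m < F.spokeLen j, (v = F.spoke j m ∧ w = F.spoke j (m + 1)) ∨
      (v = F.spoke j (m + 1) ∧ w = F.spoke j m) := by
  simpa [Sym2.eq_iff] using (F.mem_edgeSet s(v, w)).1 h

/-- The neighbours of an internal vertex of a spoke. -/
theorem adj_spoke_succ {j : Fin (n + 1)} {m : ℕ} (hm : m + 1 < F.spokeLen j) {w : V}
    (h : G.Adj (F.spoke j (m + 1)) w) : w = F.spoke j m ∨ w = F.spoke j (m + 2) := by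
  rcases F.adj_cases h with ⟨k, hk, ⟨h1, rfl⟩ | ⟨h1, rfl⟩⟩ | ⟨l, k, hk, ⟨h1, rfl⟩ | ⟨h1, rfl⟩⟩
  · have := F.spoke_eq_rim (by omega) (by omega) h1; omega
  · have := F.spoke_eq_rim (by omega) (by omega) h1; omega
  · have := F.spoke_inj (by omega) (by omega) h1
    obtain ⟨rfl, rfl⟩ : j = l ∧ m + 1 = k := by omega
    exact Or.inr rfl
  · have := F.spoke_inj (by omega) (by omega) h1
    obtain ⟨rfl, rfl⟩ : j = l ∧ m = k := by omega
    exact Or.inl rfl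

/-- The neighbours of a rim vertex other than the hub. -/
theorem adj_rim_succ {m : ℕ} (hm : m + 1 < F.rimLen) {w : V} (h : G.Adj (F.rim (m + 1)) w) :
    w = F.rim m ∨ w = F.rim (m + 2) ∨
      ∃ l, F.pos l = m + 1 ∧ w = F.spoke l (F.spokeLen l - 1) := by
  rcases F.adj_cases h with ⟨k, hk, ⟨h1, rfl⟩ | ⟨h1, rfl⟩⟩ | ⟨l, k, hk, ⟨h1, rfl⟩ | ⟨h1, rfl⟩⟩
  · have := F.rim_inj (by omega) (by omega) h1
    obtain rfl : m + 1 = k := by omega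
    exact Or.inr (Or.inl rfl)
  · have := F.rim_inj (by omega) (by omega) h1
    obtain rfl : m = k := by omega
    exact Or.inl rfl
  · have := F.spoke_eq_rim (by omega) (by omega) h1.symm; omega
  · have := F.spoke_eq_rim (by omega) (by omega) h1.symm
    exact Or.inr (Or.inr ⟨l, by omega, by congr 1; omega⟩)

/-- The neighbour of the hub in the direction of the `j`-th spoke. -/
def nbr (j : Fin (n + 1)) : V :=
  if j = 0 then F.rim 1 else if j = Fin.last n then F.rim (F.rimLen - 1) else F.spoke j 1

theorem adj_hub {w : V} (h : G.Adj F.hub w) : ∃ j, w = F.nbr j := by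
  have h3 := F.three_le_rimLen
  have hn : Fin.last n ≠ 0 := by
    intro h; have := F.pos_last; rw [h, F.pos_zero] at this; omega
  rw [← F.rim_zero] at h
  rcases F.adj_cases h with ⟨k, hk, ⟨h1, rfl⟩ | ⟨h1, rfl⟩⟩ | ⟨l, k, hk, ⟨h1, rfl⟩ | ⟨h1, rfl⟩⟩
  · have := F.rim_inj (by omega) (by omega) h1
    obtain rfl : 0 = k := by omega
    exact ⟨0, by simp [nbr]⟩
  · have := F.rim_inj (by omega) (by omega) h1
    obtain rfl : k = F.rimLen - 1 := by omega
    exact ⟨Fin.last n, by simp [nbr, hn]⟩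
  · have := F.spoke_eq_rim (by omega) (by omega) h1.symm
    obtain rfl : k = 0 := by omega
    refine ⟨l, ?_⟩
    have h0 : l ≠ 0 := by rintro rfl; simp [F.spokeLen_zero] at hk
    have h1 : l ≠ Fin.last n := by rintro rfl; simp [F.spokeLen_last] at hk
    simp [nbr, h0, h1]
  · have := F.spoke_eq_rim (by omega) (by omega) h1.symm
    have := F.two_le_spokeLen_of_lt hk
    omega

theorem nbr_injective : Function.Injective F.nbr := by
  intro j k h
  have h3 := F.three_le_rimLen
  have hspoke (l : Fin (n + 1)) (h0 : l ≠ 0) (h1 : l ≠ Fin.last n) :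
      F.spoke l 1 ≠ F.rim 1 ∧ F.spoke l 1 ≠ F.rim (F.rimLen - 1) := by
    have := F.two_le_spokeLen l h0 h1
    constructor <;> intro h <;>
    · have := F.spoke_eq_rim (by omega) (by omega) h
      omega
  have hrim : F.rim 1 ≠ F.rim (F.rimLen - 1) := fun h ↦ by
    have := F.rim_inj (by omega) (by omega) h; omega
  have hspokes (l l' : Fin (n + 1)) (h0 : l ≠ 0) (h1 : l ≠ Fin.last n)
      (h0' : l' ≠ 0) (h1' : l' ≠ Fin.last n) (h : F.spoke l 1 = F.spoke l' 1) : l = l' := by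
    have := F.two_le_spokeLen l h0 h1
    have := F.two_le_spokeLen l' h0' h1'
    have := F.spoke_inj (by omega) (by omega) h
    omega
  unfold nbr at h
  split_ifs at h <;> grind

theorem rim_edge_ne_spoke_edge {k m : ℕ} {j : Fin (n + 1)} (hk : k < F.rimLen)
    (hm : m < F.spokeLen j) :
    s(F.rim k, F.rim (k + 1)) ≠ s(F.spoke j m, F.spoke j (m + 1)) := by
  intro h
  have h2 := F.two_le_spokeLen_of_lt hm
  rcases Sym2.eq_iff.1 h with ⟨h, h'⟩ | ⟨h, h'⟩ <;>
  · have := F.spoke_eq_rim (by omega) (by omega) h.symm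
    have := F.spoke_eq_rim (by omega) (by omega) h'.symm
    omega

theorem spoke_edge_mem_iff {u : V} {c : G.Walk u u} (hc : c.IsCycle) {j : Fin (n + 1)} {m : ℕ}
    (hm : m < F.spokeLen j) :
    s(F.spoke j m, F.spoke j (m + 1)) ∈ c.edges ↔ s(F.hub, F.nbr j) ∈ c.edges := by
  induction m with
  | zero =>
    have h0 : j ≠ 0 := by rintro rfl; simp [F.spokeLen_zero] at hm
    have h1 : j ≠ Fin.last n := by rintro rfl; simp [F.spokeLen_last] at hm
    simp [nbr, h0, h1, F.spoke_zero]
  | succ m ih =>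
    rw [← ih (by omega), Sym2.eq_swap (a := F.spoke j m)]
    exact (iff_of_forall_not_or_exists_pair
      (hc.forall_notMem_or_exists_pair (F.spoke j (m + 1)))
      fun w h ↦ F.adj_spoke_succ hm (c.edges_subset_edgeSet h)).symm

theorem rim_edge_mem_iff {u : V} {c : G.Walk u u} (hc : c.IsCycle) {j k : Fin (n + 1)}
    (hjk : j ≤ k) (h : ∀ l, s(F.hub, F.nbr l) ∈ c.edges ↔ Xor (l = j) (l = k)) {m : ℕ}
    (hm : m < F.rimLen) :
    s(F.rim m, F.rim (m + 1)) ∈ c.edges ↔ F.pos j ≤ m ∧ m < F.pos k := by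
  have hle := F.pos_strictMono.monotone hjk
  induction m with
  | zero =>
    have := h 0
    simp only [nbr, if_true, ← F.rim_zero] at this
    rw [zero_add, this, ← F.pos_inj, ← F.pos_inj, F.pos_zero]
    simp only [Xor]
    omega
  | succ m ih =>
    have ih : s(F.rim (m + 1), F.rim m) ∈ c.edges ↔ F.pos j ≤ m ∧ m < F.pos k := by
      rw [Sym2.eq_swap]; exact ih (by omega)
    have hadj (w : V) (h : s(F.rim (m + 1), w) ∈ c.edges) : w = F.rim m ∨ w = F.rim (m + 2) ∨
        ∃ l, F.pos l = m + 1 ∧ w = F.spoke l (F.spokeLen l - 1) :=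
      F.adj_rim_succ hm (c.edges_subset_edgeSet h)
    by_cases hl : ∃ l, F.pos l = m + 1
    · obtain ⟨l, hl⟩ := hl
      have hl0 : l ≠ 0 := by rintro rfl; simp [F.pos_zero] at hl
      have hln : l ≠ Fin.last n := by rintro rfl; simp [F.pos_last] at hl; omega
      have h2 := F.two_le_spokeLen l hl0 hln
      have hs := F.spoke_edge_mem_iff hc (j := l) (m := F.spokeLen l - 1) (by omega)
      rw [Nat.sub_add_cancel (by omega), F.spoke_spokeLen, hl, Sym2.eq_swap, h l, ← F.pos_inj,
        ← F.pos_inj] at hs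
      have hadj' (w : V) (h : s(F.rim (m + 1), w) ∈ c.edges) : w = F.rim m ∨ w = F.rim (m + 2) ∨
          w = F.spoke l (F.spokeLen l - 1) := by
        rcases hadj w h with h | h | ⟨l', hl', rfl⟩
        · exact Or.inl h
        · exact Or.inr (Or.inl h)
        · rw [F.pos_inj.1 (hl'.trans hl.symm)]; simp
      have hne : F.rim m ≠ F.rim (m + 2) := fun h ↦ by
        have := F.three_le_rimLen
        have := F.rim_inj (by omega) (by omega) h; omega
      have hne1 : F.spoke l (F.spokeLen l - 1) ≠ F.rim m := fun h ↦ by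
        have := F.spoke_eq_rim (by omega) (by omega) h; omega
      have hne2 : F.spoke l (F.spokeLen l - 1) ≠ F.rim (m + 2) := fun h ↦ by
        have := F.spoke_eq_rim (by omega) (by omega) h; omega
      have key : Xor (s(F.rim (m + 1), F.rim m) ∈ c.edges)
          (s(F.rim (m + 1), F.spoke l (F.spokeLen l - 1)) ∈ c.edges) ↔
          s(F.rim (m + 1), F.rim (m + 2)) ∈ c.edges :=
        xor_iff_of_forall_not_or_exists_pair
          (hc.forall_notMem_or_exists_pair (F.rim (m + 1))) hne hne1 hne2 hadj'
      rw [← key, ih, hs]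
      simp only [Xor]
      omega
    · have hj : F.pos j ≠ m + 1 := fun h ↦ hl ⟨j, h⟩
      have hk : F.pos k ≠ m + 1 := fun h ↦ hl ⟨k, h⟩
      have hadj' (w : V) (h : s(F.rim (m + 1), w) ∈ c.edges) :
          w = F.rim m ∨ w = F.rim (m + 2) := by
        rcases hadj w h with h | h | ⟨l', hl', rfl⟩
        · exact Or.inl h
        · exact Or.inr h
        · exact (hl ⟨l', hl'⟩).elim
      have key : s(F.rim (m + 1), F.rim m) ∈ c.edges ↔
          s(F.rim (m + 1), F.rim (m + 2)) ∈ c.edges :=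
        iff_of_forall_not_or_exists_pair
          (hc.forall_notMem_or_exists_pair (F.rim (m + 1))) hadj'
      rw [← key, ih]
      omega

theorem exists_hub_pair {u : V} {c : G.Walk u u} (hc : c.IsCycle) :
    ∃ j k : Fin (n + 1), j ≤ k ∧ ∀ l, s(F.hub, F.nbr l) ∈ c.edges ↔ Xor (l = j) (l = k) := by
  rcases hc.forall_notMem_or_exists_pair F.hub with h | ⟨a, b, hab, h⟩
  · exact ⟨0, 0, le_rfl, fun l ↦ by simp [h]⟩
  · obtain ⟨j, rfl⟩ := F.adj_hub (c.edges_subset_edgeSet ((h a).2 (Or.inl rfl)))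
    obtain ⟨k, rfl⟩ := F.adj_hub (c.edges_subset_edgeSet ((h b).2 (Or.inr rfl)))
    rw [F.nbr_injective.ne_iff] at hab
    rcases lt_or_gt_of_ne hab with hlt | hlt
    · exact ⟨j, k, hlt.le, fun l ↦ by
        rw [h, F.nbr_injective.eq_iff, F.nbr_injective.eq_iff]; simp only [Xor]; grind⟩
    · exact ⟨k, j, hlt.le, fun l ↦ by
        rw [h, F.nbr_injective.eq_iff, F.nbr_injective.eq_iff]; simp only [Xor]; grind⟩

variable [DecidableEq V]

/-- The edges of the cycle that leaves the hub along the `j`-th spoke, follows the rim, and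
returns along the `k`-th spoke. -/
def cycleEdges (p : Fin (n + 1) × Fin (n + 1)) : Finset (Sym2 V) :=
  ((Finset.range (F.spokeLen p.1)).image fun m ↦ s(F.spoke p.1 m, F.spoke p.1 (m + 1))) ∪
  ((Finset.Ico (F.pos p.1) (F.pos p.2)).image fun m ↦ s(F.rim m, F.rim (m + 1))) ∪
  ((Finset.range (F.spokeLen p.2)).image fun m ↦ s(F.spoke p.2 m, F.spoke p.2 (m + 1)))

theorem mem_cycleEdges {p : Fin (n + 1) × Fin (n + 1)} {e : Sym2 V} :
    e ∈ F.cycleEdges p ↔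
      (∃ m < F.spokeLen p.1, e = s(F.spoke p.1 m, F.spoke p.1 (m + 1))) ∨
      (∃ m, (F.pos p.1 ≤ m ∧ m < F.pos p.2) ∧ e = s(F.rim m, F.rim (m + 1))) ∨
      (∃ m < F.spokeLen p.2, e = s(F.spoke p.2 m, F.spoke p.2 (m + 1))) := by
  simp only [cycleEdges, Finset.mem_union, Finset.mem_image, Finset.mem_range, Finset.mem_Ico,
    or_assoc, eq_comm (a := e)]

theorem rim_edge_mem_cycleEdges {p : Fin (n + 1) × Fin (n + 1)} {k : ℕ} (hk : k < F.rimLen) :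
    s(F.rim k, F.rim (k + 1)) ∈ F.cycleEdges p ↔ F.pos p.1 ≤ k ∧ k < F.pos p.2 := by
  rw [mem_cycleEdges]
  constructor
  · rintro (⟨m, hm, h⟩ | ⟨m, hm, h⟩ | ⟨m, hm, h⟩)
    · exact (F.rim_edge_ne_spoke_edge hk hm h).elim
    · have hp := F.pos_le p.2
      have h3 := F.three_le_rimLen
      obtain rfl : k = m := by
        rcases Sym2.eq_iff.1 h with ⟨h, h'⟩ | ⟨h, h'⟩ <;>
        · have := F.rim_inj (by omega) (by omega) h
          have := F.rim_inj (by omega) (by omega) h'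
          omega
      exact hm
    · exact (F.rim_edge_ne_spoke_edge hk hm h).elim
  · exact fun h ↦ Or.inr (Or.inl ⟨k, h, rfl⟩)

theorem cycleEdges_injOn : Set.InjOn F.cycleEdges {p | p.1 < p.2} := by
  intro p hp p' hp' h
  have key (k : ℕ) (hk : k < F.rimLen) :
      (F.pos p.1 ≤ k ∧ k < F.pos p.2) ↔ (F.pos p'.1 ≤ k ∧ k < F.pos p'.2) := by
    rw [← F.rim_edge_mem_cycleEdges hk, h, F.rim_edge_mem_cycleEdges hk]
  have h1 := F.pos_strictMono hp
  have h1' := F.pos_strictMono hp'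
  have h2 := F.pos_le p.2
  have h2' := F.pos_le p'.2
  have k1 := key (F.pos p.1) (by omega)
  have k2 := key (F.pos p'.1) (by omega)
  have k3 := key (F.pos p.2 - 1) (by omega)
  have k4 := key (F.pos p'.2 - 1) (by omega)
  exact Prod.ext (F.pos_inj.1 (by omega)) (F.pos_inj.1 (by omega))

theorem exists_isCycle {p : Fin (n + 1) × Fin (n + 1)} (hp : p.1 < p.2) :
    ∃ c : G.Walk F.hub F.hub, c.IsCycle ∧ c.edges.toFinset = F.cycleEdges p ∧
      c.length = F.spokeLen p.1 + (F.pos p.2 - F.pos p.1) + F.spokeLen p.2 := by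
  obtain ⟨j, k⟩ := p
  dsimp only at hp ⊢
  have hjk := F.pos_strictMono hp
  have hk := F.pos_le k
  have hk0 : k ≠ 0 := Fin.pos_iff_ne_zero.1 ((Fin.zero_le j).trans_lt hp)
  have hjn : j ≠ Fin.last n := Fin.lt_last_iff_ne_last.1 (hp.trans_le (Fin.le_last k))
  obtain ⟨a, as, ae⟩ := exists_walk_of_adj (G := G) (F.spoke j) (F.spokeLen j)
    fun m hm ↦ F.adj_spoke hm
  obtain ⟨b, bs, be⟩ := exists_walk_of_adj (G := G) (fun m ↦ F.rim (F.pos j + m))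
    (F.pos k - F.pos j) fun m hm ↦ F.adj_rim (by omega)
  obtain ⟨d, ds, de⟩ := exists_walk_of_adj (G := G) (fun m ↦ F.spoke k (F.spokeLen k - m))
    (F.spokeLen k) fun m hm ↦ by
      have := F.adj_spoke (j := k) (m := F.spokeLen k - (m + 1)) (by omega)
      rw [show F.spokeLen k - (m + 1) + 1 = F.spokeLen k - m by omega] at this
      exact this.symm
  have e1 := F.spoke_spokeLen j
  have e2 : F.rim (F.pos j + (F.pos k - F.pos j)) = F.spoke k (F.spokeLen k - 0) := by
    rw [Nat.sub_zero, F.spoke_spokeLen k]; congr 1; omega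
  let c := (a.copy (F.spoke_zero j) e1).append
    ((b.copy rfl e2).append (d.copy rfl (by rw [Nat.sub_self, F.spoke_zero])))
  have hlen : c.length = F.spokeLen j + (F.pos k - F.pos j) + F.spokeLen k := by
    rw [← SimpleGraph.Walk.length_edges]
    simp [c, SimpleGraph.Walk.edges_append, ae, be, de, -SimpleGraph.Walk.length_edges]
    omega
  refine ⟨c, SimpleGraph.Walk.isCycle_of_nodup_tail_support ?_ ?_, ?_, hlen⟩
  · simp only [c, SimpleGraph.Walk.tail_support_append, SimpleGraph.Walk.support_copy, as, bs, ds,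
      List.range_succ_eq_map, List.map_cons, List.tail_cons, List.map_map]
    simp only [List.nodup_append, List.mem_append, List.mem_map, List.mem_range,
      Function.comp_apply, Nat.succ_eq_add_one]
    refine ⟨?_, ⟨?_, ?_, ?_⟩, ?_⟩
    · refine List.Nodup.map_on (fun m hm m' hm' h ↦ ?_) List.nodup_range
      rw [List.mem_range] at hm hm'
      have := F.spoke_inj (by grind) (by grind) h
      grind
    · refine List.Nodup.map_on (fun m hm m' hm' h ↦ ?_) List.nodup_range
      rw [List.mem_range] at hm hm'
      have := F.rim_inj (by grind) (by grind) h
      grind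
    · refine List.Nodup.map_on (fun m hm m' hm' h ↦ ?_) List.nodup_range
      rw [List.mem_range] at hm hm'
      have := F.spoke_inj (by grind) (by grind) h
      grind
    · rintro _ ⟨m, hm, rfl⟩ _ ⟨m', hm', rfl⟩ h
      have := F.spoke_eq_rim (by omega) (by omega) h.symm
      have := F.two_le_spokeLen_of_lt hm'
      omega
    · rintro _ ⟨m, hm, rfl⟩ _ (⟨m', hm', rfl⟩ | ⟨m', hm', rfl⟩) h
      · have := F.spoke_eq_rim (by omega) (by omega) h
        omega
      · have := F.spoke_inj (by omega) (by omega) h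
        have := hp.ne
        omega
  · rw [hlen]
    have h3 := F.three_le_rimLen
    by_cases hj : j = 0
    · subst hj
      by_cases hk : k = Fin.last n
      · subst hk
        have := F.pos_zero
        have := F.pos_last
        omega
      · have := F.two_le_spokeLen k hk0 hk
        omega
    · have := F.two_le_spokeLen j hj hjn
      omega
  · ext e
    rw [mem_cycleEdges]
    simp only [c, SimpleGraph.Walk.edges_append, SimpleGraph.Walk.edges_copy, ae, be, de,
      List.mem_toFinset, List.mem_append, List.mem_map, List.mem_range]
    refine or_congr (by grind) (or_congr ⟨?_, ?_⟩ ⟨?_, ?_⟩)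
    · rintro ⟨m, hm, rfl⟩
      exact ⟨_, ⟨by omega, by omega⟩, rfl⟩
    · rintro ⟨m, hm, rfl⟩
      refine ⟨m - F.pos j, by omega, ?_⟩
      rw [show F.pos j + (m - F.pos j + 1) = F.pos j + (m - F.pos j) + 1 by omega,
        show F.pos j + (m - F.pos j) = m by omega]
    · rintro ⟨m, hm, rfl⟩
      refine ⟨F.spokeLen k - (m + 1), by omega, ?_⟩
      rw [show F.spokeLen k - (m + 1) + 1 = F.spokeLen k - m by omega, Sym2.eq_swap]
    · rintro ⟨m, hm, rfl⟩
      refine ⟨F.spokeLen k - (m + 1), by omega, ?_⟩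
      rw [show F.spokeLen k - (F.spokeLen k - (m + 1)) = m + 1 by omega,
        show F.spokeLen k - (F.spokeLen k - (m + 1) + 1) = m by omega, Sym2.eq_swap]

theorem card_cycleEdges {p : Fin (n + 1) × Fin (n + 1)} (hp : p.1 < p.2) :
    (F.cycleEdges p).card =
      F.spokeLen p.1 + (F.pos p.2 - F.pos p.1) + F.spokeLen p.2 := by
  obtain ⟨c, hc, he, hl⟩ := F.exists_isCycle hp
  rw [← he, ← hl, List.toFinset_card_of_nodup hc.edges_nodup, SimpleGraph.Walk.length_edges]

theorem exists_eq_cycleEdges {u : V} {c : G.Walk u u} (hc : c.IsCycle) :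
    ∃ p : Fin (n + 1) × Fin (n + 1), p.1 < p.2 ∧ c.edges.toFinset = F.cycleEdges p := by
  obtain ⟨j, k, hjk, h⟩ := F.exists_hub_pair hc
  have hmem (e : Sym2 V) : e ∈ c.edges → j < k ∧ e ∈ F.cycleEdges (j, k) := by
    intro he
    rw [mem_cycleEdges]
    rcases (F.mem_edgeSet e).1 (c.edges_subset_edgeSet he) with ⟨m, hm, rfl⟩ | ⟨l, m, hm, rfl⟩
    · rw [F.rim_edge_mem_iff hc hjk h hm] at he
      exact ⟨F.pos_strictMono.lt_iff_lt.1 (by omega), Or.inr (Or.inl ⟨m, he, rfl⟩)⟩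
    · rw [F.spoke_edge_mem_iff hc hm, h] at he
      rcases he with ⟨rfl, hne⟩ | ⟨rfl, hne⟩
      · exact ⟨lt_of_le_of_ne hjk hne, Or.inl ⟨m, hm, rfl⟩⟩
      · exact ⟨lt_of_le_of_ne' hjk hne, Or.inr (Or.inr ⟨m, hm, rfl⟩)⟩
  have hlt : j < k := by
    obtain ⟨e, he⟩ := List.exists_mem_of_length_pos (l := c.edges) (by
      rw [SimpleGraph.Walk.length_edges]; have := hc.three_le_length; omega)
    exact (hmem e he).1
  refine ⟨(j, k), hlt, ?_⟩
  ext e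
  rw [List.mem_toFinset]
  refine ⟨fun he ↦ (hmem e he).2, fun he ↦ ?_⟩
  rcases F.mem_cycleEdges.1 he with ⟨m, hm, rfl⟩ | ⟨m, hm, rfl⟩ | ⟨m, hm, rfl⟩
  · rw [F.spoke_edge_mem_iff hc hm, h]
    exact Or.inl ⟨rfl, hlt.ne⟩
  · exact (F.rim_edge_mem_iff hc hjk h (hm.2.trans_le (F.pos_le k))).2 hm
  · rw [F.spoke_edge_mem_iff hc hm, h]
    exact Or.inr ⟨rfl, hlt.ne'⟩

theorem setOf_cycle_edges :
    {s | ∃ (w : V) (c : G.Walk w w), c.IsCycle ∧ c.edges.toFinset = s} =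
      F.cycleEdges '' {p | p.1 < p.2} := by
  ext s
  constructor
  · rintro ⟨w, c, hc, rfl⟩
    obtain ⟨p, hp, h⟩ := F.exists_eq_cycleEdges hc
    exact ⟨p, hp, h.symm⟩
  · rintro ⟨p, hp, rfl⟩
    obtain ⟨c, hc, h, -⟩ := F.exists_isCycle hp
    exact ⟨F.hub, c, hc, h⟩

end Fan

/-- The fan formed by a cycle and internally disjoint paths from a vertex `x` of the cycle to other
vertices of the cycle. -/
def Fan.ofWalks {V : Type*} {G : SimpleGraph V} {x : V} {C : G.Walk x x} {m : ℕ} {a : Fin m → ℕ}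
    (hC : C.IsCycle) (ha : StrictMono a) (ha0 : ∀ j, 0 < a j) (haL : ∀ j, a j < C.length)
    {P : (j : Fin m) → G.Walk x (C.getVert (a j))} (hP : ∀ j, (P j).IsPath)
    (hP2 : ∀ j, 2 ≤ (P j).length)
    (hPC : ∀ j, ∀ w : V, w ∈ (P j).support → w ∈ C.support → w = x ∨ w = C.getVert (a j))
    (hPP : ∀ j j', j ≠ j' → ∀ w : V, w ∈ (P j).support → w ∈ (P j').support → w = x)
    (hG : G.edgeSet = {e | e ∈ C.edges} ∪ ⋃ j, {e | e ∈ (P j).edges}) : Fan G (m + 1) where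
  hub := x
  rimLen := C.length
  rim := C.getVert
  pos := Fin.cons 0 (Fin.snoc a C.length : Fin (m + 1) → ℕ)
  spokeLen := Fin.cons 0 (Fin.snoc (fun j ↦ (P j).length) 0 : Fin (m + 1) → ℕ)
  spoke := Fin.cons (fun _ ↦ x)
    (Fin.snoc (fun j ↦ (P j).getVert) (fun _ ↦ x) : Fin (m + 1) → ℕ → V)
  three_le_rimLen := hC.three_le_length
  pos_strictMono := by
    have := hC.three_le_length
    intro j k hjk
    induction j using Fin.cases with
    | zero =>
      induction k using Fin.cases with
      | zero => simp at hjk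
      | succ k =>
        induction k using Fin.lastCases with
        | last => simp; omega
        | cast k => simpa using ha0 k
    | succ j =>
      induction k using Fin.cases with
      | zero => simp at hjk
      | succ k =>
        rw [Fin.succ_lt_succ_iff] at hjk
        induction j using Fin.lastCases with
        | last => exact absurd hjk (Fin.le_last k).not_gt
        | cast j =>
          induction k using Fin.lastCases with
          | last => simpa using haL j
          | cast k => simpa using ha (Fin.castSucc_lt_castSucc_iff.1 hjk)
  pos_zero := rfl
  pos_last := by simp [← Fin.succ_last]
  spokeLen_zero := rfl
  spokeLen_last := by simp [← Fin.succ_last]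
  two_le_spokeLen j h0 h1 := by
    induction j using Fin.cases with
    | zero => exact absurd rfl h0
    | succ j =>
      induction j using Fin.lastCases with
      | last => exact absurd (Fin.succ_last _) h1
      | cast j => simpa using hP2 j
  rim_zero := C.getVert_zero
  rim_rimLen := C.getVert_length
  spoke_zero j := by
    induction j using Fin.cases with
    | zero => rfl
    | succ j => induction j using Fin.lastCases <;> simp
  spoke_spokeLen j := by
    induction j using Fin.cases with
    | zero => simp
    | succ j => induction j using Fin.lastCases <;> simp
  rim_inj {k k'} hk hk' h := by
    have := hC.three_le_length
    by_cases h0 : k = 0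
    · subst h0
      rw [C.getVert_zero, eq_comm, hC.getVert_endpoint_iff hk'] at h
      omega
    · by_cases h0' : k' = 0
      · subst h0'
        rw [C.getVert_zero, hC.getVert_endpoint_iff hk] at h
        omega
      · exact Or.inl (hC.getVert_injOn ⟨by omega, hk⟩ ⟨by omega, hk'⟩ h)
  spoke_inj {j k j' k'} hk hk' h := by
    induction j using Fin.cases with
    | zero =>
      obtain rfl : k = 0 := by simpa using hk
      induction j' using Fin.cases with
      | zero => exact Or.inl ⟨rfl, by simpa using hk'⟩
      | succ j' =>
        induction j' using Fin.lastCases with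
        | last => exact Or.inl ⟨rfl, by simpa using hk'⟩
        | cast j' =>
          simp only [Fin.cons_succ, Fin.snoc_castSucc, Fin.cons_zero] at hk' h
          exact Or.inl ⟨rfl, ((hP j').getVert_eq_start_iff hk').1 h.symm⟩
    | succ j =>
      induction j using Fin.lastCases with
      | last =>
        obtain rfl : k = 0 := by simpa using hk
        induction j' using Fin.cases with
        | zero => exact Or.inl ⟨rfl, by simpa using hk'⟩
        | succ j' =>
          induction j' using Fin.lastCases with
          | last => exact Or.inl ⟨rfl, by simpa using hk'⟩
          | cast j' =>
            simp only [Fin.cons_succ, Fin.snoc_castSucc, Fin.snoc_last] at hk' h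
            exact Or.inl ⟨rfl, ((hP j').getVert_eq_start_iff hk').1 h.symm⟩
      | cast j =>
        simp only [Fin.cons_succ, Fin.snoc_castSucc] at hk h
        induction j' using Fin.cases with
        | zero =>
          exact Or.inl ⟨((hP j).getVert_eq_start_iff hk).1 (by simpa using h), by simpa using hk'⟩
        | succ j' =>
          induction j' using Fin.lastCases with
          | last =>
            exact Or.inl ⟨((hP j).getVert_eq_start_iff hk).1 (by simpa using h), by simpa using hk'⟩
          | cast j' =>
            simp only [Fin.cons_succ, Fin.snoc_castSucc] at hk' h
            by_cases hj : j = j'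
            · subst hj
              exact Or.inr ⟨rfl, (hP j).getVert_injOn hk hk' h⟩
            · have hx := hPP j j' hj _ ((P j).getVert_mem_support k)
                (h ▸ (P j').getVert_mem_support k')
              exact Or.inl ⟨((hP j).getVert_eq_start_iff hk).1 hx,
                ((hP j').getVert_eq_start_iff hk').1 (h ▸ hx)⟩
  spoke_eq_rim {j k l} hk hl h := by
    induction j using Fin.cases with
    | zero =>
      refine Or.inl ⟨by simpa using hk, (hC.getVert_endpoint_iff hl).1 ?_⟩
      simpa using h.symm
    | succ j =>
      induction j using Fin.lastCases with
      | last =>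
        refine Or.inl ⟨by simpa using hk, (hC.getVert_endpoint_iff hl).1 ?_⟩
        simpa using h.symm
      | cast j =>
        simp only [Fin.cons_succ, Fin.snoc_castSucc] at hk h ⊢
        rcases hPC j _ ((P j).getVert_mem_support k) (h ▸ C.getVert_mem_support l) with hx | hx
        · exact Or.inl ⟨((hP j).getVert_eq_start_iff hk).1 hx,
            (hC.getVert_endpoint_iff hl).1 (h ▸ hx)⟩
        · refine Or.inr ⟨((hP j).getVert_eq_end_iff hk).1 hx, ?_⟩
          have h0 := ha0 j
          have h1 := haL j
          have hl0 : l ≠ 0 := by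
            rintro rfl
            rw [h, C.getVert_zero, eq_comm, hC.getVert_endpoint_iff h1.le] at hx
            omega
          exact hC.getVert_injOn ⟨by omega, hl⟩ ⟨h0, h1.le⟩ (h ▸ hx)
  mem_edgeSet e := by
    have key {u v : V} (p : G.Walk u v) :
        e ∈ p.edges ↔ ∃ k < p.length, e = s(p.getVert k, p.getVert (k + 1)) := by
      induction e with
      | h a b => rw [p.mk_mem_edges_iff_exists]; simp only [eq_comm]
    rw [hG, Fin.exists_fin_succ, Fin.exists_fin_succ']
    simp [key]

theorem strictMono_attachIdx {t i : ℕ} (ht : 115 ≤ t) : StrictMono (attachIdx t i) := by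
  rw [Fin.strictMono_iff_lt_succ]
  intro j
  fin_cases j <;> simp [attachIdx] <;> omega

/-- The subgraph `B_{27t+i-57}` of the construction: a cycle of length `132t + 11i + 894`
through `x` together with ten paths from `x`, internally disjoint from the cycle and from
each other, with the prescribed lengths and attachment vertices, contains exactly 66
cycles, whose multiset of lengths is the prescribed one. -/
theorem stmt5 {V : Type*} [DecidableEq V] (r t i : ℕ)
    (hr : 1 ≤ r) (ht : t = 1260 * r + 169) (hi₁ : 58 ≤ i) (hi₂ : i ≤ t - 742)
    (G : SimpleGraph V) (x : V) (C : G.Walk x x)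
    (hC : C.IsCycle) (hClen : C.length = 132 * t + 11 * i + 894)
    (P : (j : Fin 10) → G.Walk x (C.getVert (attachIdx t i j)))
    (hP : ∀ j, (P j).IsPath)
    (hPlen : ∀ j, (P j).length = pathLen t j)
    (hPC : ∀ j, ∀ w : V, w ∈ (P j).support → w ∈ C.support →
      w = x ∨ w = C.getVert (attachIdx t i j))
    (hPP : ∀ j j', j ≠ j' → ∀ w : V, w ∈ (P j).support → w ∈ (P j').support → w = x)
    (hG : G.edgeSet = {e | e ∈ C.edges} ∪ ⋃ j, {e | e ∈ (P j).edges}) :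
    ∃ S : Finset (Finset (Sym2 V)),
      (↑S : Set (Finset (Sym2 V))) =
        {s | ∃ (w : V) (c : G.Walk w w), c.IsCycle ∧ c.edges.toFinset = s} ∧
      S.card = 66 ∧
      S.val.map Finset.card = cycleLengths t i := by
  have hpos (j : Fin 10) : 0 < attachIdx t i j := by
    fin_cases j <;> simp [attachIdx] <;> omega
  have hlt (j : Fin 10) : attachIdx t i j < C.length := by
    rw [hClen]
    fin_cases j <;> simp [attachIdx] <;> omega
  have hlen (j : Fin 10) : 2 ≤ (P j).length := by
    rw [hPlen]
    fin_cases j <;> simp [pathLen] <;> omega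
  let F : Fan G 11 :=
    Fan.ofWalks hC (strictMono_attachIdx (by omega)) hpos hlt hP hlen hPC hPP hG
  obtain ⟨A, hA⟩ : ∃ A : Fin 12 → ℕ, F.pos = A := ⟨_, rfl⟩
  obtain ⟨l, hl⟩ : ∃ l : Fin 12 → ℕ, F.spokeLen = l := ⟨_, rfl⟩
  have hpairs : (Finset.univ.filter fun p : Fin 12 × Fin 12 ↦ p.1 < p.2).val =
    {(0, 1), (1, 2), (2, 3), (3, 4), (4, 5), (5, 6), (6, 7), (7, 8), (8, 9), (9, 10), (10, 11),
     (0, 2), (1, 3), (2, 4), (3, 5), (4, 6), (5, 7), (6, 8), (7, 9), (8, 10), (9, 11), (0, 3),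
     (1, 4), (2, 5), (3, 6), (4, 7), (5, 8), (6, 9), (7, 10), (8, 11), (0, 4), (1, 5), (2, 6),
     (3, 7), (4, 8), (5, 9), (6, 10), (7, 11), (0, 5), (1, 6), (2, 7), (3, 8), (4, 9), (5, 10),
     (6, 11), (0, 6), (1, 7), (2, 8), (3, 9), (4, 10), (5, 11), (0, 7), (1, 8), (2, 9), (3, 10),
     (4, 11), (0, 8), (1, 9), (2, 10), (3, 11), (0, 9), (1, 10), (2, 11),
     (0, 10), (1, 11), (0, 11)} := by decide
  have hinj : Set.InjOn F.cycleEdges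
      ↑(Finset.univ.filter fun p : Fin 12 × Fin 12 ↦ p.1 < p.2) := by
    simpa using F.cycleEdges_injOn
  refine ⟨(Finset.univ.filter fun p : Fin 12 × Fin 12 ↦ p.1 < p.2).image F.cycleEdges, ?_, ?_, ?_⟩
  · rw [F.setOf_cycle_edges]
    simp
  · rw [Finset.card_image_of_injOn hinj]
    decide
  · rw [Finset.image_val_of_injOn hinj, Multiset.map_map]
    rw [Multiset.map_congr (g := fun p ↦ l p.1 + (A p.2 - A p.1) + l p.2) rfl fun p hp ↦ by
      rw [Function.comp_apply, F.card_cycleEdges (by simpa using hp), hA, hl]]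
    rw [hpairs]
    obtain ⟨u, rfl⟩ : ∃ u, t = 2 * u + 1 := ⟨630 * r + 84, by omega⟩
    have A0 : A 0 = 0 := by rw [← hA]; rfl
    have l0 : l 0 = 0 := by rw [← hl]; rfl
    have A1 : A 1 = 37 * u - 39 + i := by
      rw [← hA]; change attachIdx (2 * u + 1) i 0 = _; simp [attachIdx]; omega
    have l1 : l 1 = 17 * u + 9 := by
      rw [← hl]; refine (hPlen 0).trans ?_; simp [pathLen]; omega
    have A2 : A 2 = 57 * u - 23 + 2 * i := by
      rw [← hA]; change attachIdx (2 * u + 1) i 1 = _; simp [attachIdx]; omega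
    have l2 : l 2 = 19 * u + 10 := by
      rw [← hl]; refine (hPlen 1).trans ?_; simp [pathLen]; omega
    have A3 : A 3 = 77 * u + 196 + 3 * i := by
      rw [← hA]; change attachIdx (2 * u + 1) i 2 = _; simp [attachIdx]; omega
    have l3 : l 3 = 19 * u + 10 := by
      rw [← hl]; refine (hPlen 2).trans ?_; simp [pathLen]; omega
    have A4 : A 4 = 97 * u + 205 + 4 * i := by
      rw [← hA]; change attachIdx (2 * u + 1) i 3 = _; simp [attachIdx]; omega
    have l4 : l 4 = 21 * u + 11 := by
      rw [← hl]; refine (hPlen 3).trans ?_; simp [pathLen]; omega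
    have A5 : A 5 = 117 * u + 215 + 5 * i := by
      rw [← hA]; change attachIdx (2 * u + 1) i 4 = _; simp [attachIdx]; omega
    have l5 : l 5 = 21 * u + 11 := by
      rw [← hl]; refine (hPlen 4).trans ?_; simp [pathLen]; omega
    have A6 : A 6 = 137 * u + 224 + 6 * i := by
      rw [← hA]; change attachIdx (2 * u + 1) i 5 = _; simp [attachIdx]; omega
    have l6 : l 6 = 23 * u + 12 := by
      rw [← hl]; refine (hPlen 5).trans ?_; simp [pathLen]; omega
    have A7 : A 7 = 157 * u + 233 + 7 * i := by
      rw [← hA]; change attachIdx (2 * u + 1) i 6 = _; simp [attachIdx]; omega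
    have l7 : l 7 = 23 * u + 12 := by
      rw [← hl]; refine (hPlen 6).trans ?_; simp [pathLen]; omega
    have A8 : A 8 = 177 * u + 237 + 8 * i := by
      rw [← hA]; change attachIdx (2 * u + 1) i 7 = _; simp [attachIdx]; omega
    have l8 : l 8 = 25 * u + 13 := by
      rw [← hl]; refine (hPlen 7).trans ?_; simp [pathLen]; omega
    have A9 : A 9 = 197 * u + 249 + 9 * i := by
      rw [← hA]; change attachIdx (2 * u + 1) i 8 = _; simp [attachIdx]; omega
    have l9 : l 9 = 25 * u + 13 := by
      rw [← hl]; refine (hPlen 8).trans ?_; simp [pathLen]; omega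
    have A10 : A 10 = 217 * u + 261 + 10 * i := by
      rw [← hA]; change attachIdx (2 * u + 1) i 9 = _; simp [attachIdx]; omega
    have l10 : l 10 = 27 * u + 14 := by
      rw [← hl]; refine (hPlen 9).trans ?_; simp [pathLen]; omega
    have A11 : A 11 = 264 * u + 11 * i + 1026 := by rw [← hA]; exact hClen.trans (by omega)
    have l11 : l 11 = 0 := by rw [← hl]; rfl
    simp only [cycleLengths, Multiset.insert_eq_cons, Multiset.map_cons, Multiset.map_singleton,
      A0, A1, A2, A3, A4, A5, A6, A7, A8, A9, A10, A11,
      l0, l1, l2, l3, l4, l5, l6, l7, l8, l9, l10, l11]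
    repeat' refine congrArg₂ Multiset.cons ?_ ?_
    all_goals first | omega | rfl
end
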